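/- arXiv:1311.0750 — 4 statements merged into one kernel-verified Lean document; each statement's English description precedes it below -/
import Mathlib

section
/- For every Mondshein sequence of a finite simple graph G avoiding an edge ru, there exists an induced Mondshein sequence of G avoiding ru; in particular, every 3-connected graph G with an edge ru has an induced Mondshein sequence avoiding ru. -/
open SimpleGraph

universe u

variable {V : Type u}

/-- An ear decomposition `(P₀, P₁, …, P_k)` of a graph `G`: `P₀` is a cycle and each
subsequent ear `Pᵢ` (`1 ≤ i ≤ k`, here indexed by `Fin k`) is a path that intersects the
union of the previous ears exactly in its two endpoints; the edge sets of the ears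
partition the edge set of `G`. -/
structure EarDecomposition {V : Type u} (G : SimpleGraph V) where
  /-- the number of path-ears; the ears are `P₀, P₁, …, P_k`. -/
  k : ℕ
  /-- base point of the initial cycle `P₀` -/
  v0 : V
  /-- the initial ear `P₀` -/
  cycle : G.Walk v0 v0
  cycle_isCycle : cycle.IsCycle
  /-- the first endpoint of the ear `Pᵢ` -/
  s : Fin k → V
  /-- the second endpoint of the ear `Pᵢ` -/
  t : Fin k → V
  /-- the ear `Pᵢ`, `1 ≤ i ≤ k` (indexed here by `i-1 : Fin k`) -/
  path : (i : Fin k) → G.Walk (s i) (t i)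
  path_isPath : ∀ i, (path i).IsPath
  path_length_pos : ∀ i, 0 < (path i).length
  /-- the ears cover all edges of `G` -/
  edges_cover : ∀ e ∈ G.edgeSet, e ∈ cycle.edges ∨ ∃ i, e ∈ (path i).edges
  /-- distinct ears have disjoint edge sets -/
  cycle_path_disjoint : ∀ (i : Fin k), ∀ e ∈ (path i).edges, e ∉ cycle.edges
  path_path_disjoint : ∀ i j : Fin k, i ≠ j → ∀ e ∈ (path i).edges, e ∉ (path j).edges
  /-- each ear intersects the union of the previous ears exactly in its endpoints -/
  meets_prev : ∀ (i : Fin k), ∀ x ∈ (path i).support,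
    ((x ∈ cycle.support ∨ ∃ j, j < i ∧ x ∈ (path j).support) ↔ (x = s i ∨ x = t i))

namespace EarDecomposition

variable {G : SimpleGraph V} (D : EarDecomposition G)

/-- The `i`-th ear `Pᵢ` as a subgraph of `G` (`P₀` is the initial cycle). -/
def ear (i : ℕ) : G.Subgraph :=
  if i = 0 then D.cycle.toSubgraph
  else if h : i - 1 < D.k then (D.path ⟨i - 1, h⟩).toSubgraph else ⊥

/-- The vertex set of the `i`-th ear. -/
def earSupport (i : ℕ) : Set V := (D.ear i).verts

/-- The edge set of the `i`-th ear. -/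
def earEdges (i : ℕ) : Set (Sym2 V) := (D.ear i).edgeSet

/-- The set of inner vertices of the `i`-th ear: for a path-ear, the vertices that are
not endpoints; every vertex of the initial cycle `P₀` counts as inner. -/
def inner (i : ℕ) : Set V :=
  if i = 0 then D.earSupport 0
  else if h : i - 1 < D.k then
    {x | x ∈ (D.path ⟨i - 1, h⟩).support ∧ x ≠ D.s ⟨i - 1, h⟩ ∧ x ≠ D.t ⟨i - 1, h⟩}
  else ∅

/-- Ear `Pᵢ` is long if it is not a single edge. -/
def IsLong (i : ℕ) : Prop :=
  i = 0 ∨ ∃ h : i - 1 < D.k, 2 ≤ (D.path ⟨i - 1, h⟩).length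

/-- The subgraph `G_i = P₀ ∪ P₁ ∪ ⋯ ∪ P_i`. -/
def partialGraph (i : ℕ) : G.Subgraph := ⨆ j ∈ Finset.range (i + 1), D.ear j

/-- `V̄ᵢ = V(G) − V(G_i)`. -/
def Vbar (i : ℕ) : Set V := (D.partialGraph i).vertsᶜ

/-- `Ḡᵢ`, the subgraph of `G` induced by `V̄ᵢ`. -/
def Gbar (i : ℕ) : G.Subgraph := (⊤ : G.Subgraph).induce (D.Vbar i)

/-- An ear decomposition is non-separating if, for every `i`, every inner vertex of `Pᵢ`
has a neighbor in `Ḡᵢ` unless `Ḡᵢ` is empty. -/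
def NonSeparating : Prop :=
  ∀ i ≤ D.k, (D.Vbar i).Nonempty → ∀ x ∈ D.inner i, ∃ y ∈ D.Vbar i, G.Adj x y

/-- `birth v` is the minimal `i` such that `Pᵢ` contains `v`. -/
noncomputable def birth (v : V) : ℕ := sInf {i | v ∈ D.earSupport i}

/-- `birthEdge e` is the index `i` such that `Pᵢ` contains the edge `e`. -/
noncomputable def birthEdge (e : Sym2 V) : ℕ := sInf {i | e ∈ D.earEdges i}

end EarDecomposition

/-- A graph is `k`-connected if it has more than `k` vertices and deleting any set of
fewer than `k` vertices leaves it connected. -/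
def KConnected (k : ℕ) (G : SimpleGraph V) : Prop :=
  k + 1 ≤ Nat.card V ∧ ∀ S : Set V, S.ncard < k → (G.induce Sᶜ).Connected

/-- A Mondshein sequence avoiding the edge `ru`: an ear decomposition of `G` such that
(1) `r ∈ P₀`; (2) `P_{birth u}` is the last long ear, contains `u` as its only inner
vertex and does not contain the edge `ru`; (3) the decomposition is non-separating. -/
def IsMondshein {G : SimpleGraph V} (D : EarDecomposition G) (r u : V) : Prop :=
  r ∈ D.earSupport 0 ∧
  D.IsLong (D.birth u) ∧
  (∀ j ≤ D.k, D.IsLong j → j ≤ D.birth u) ∧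
  D.inner (D.birth u) = {u} ∧
  s(r, u) ∉ D.earEdges (D.birth u) ∧
  D.NonSeparating

/-- A Mondshein sequence (more generally, an ear decomposition) is induced if `P₀` is an
induced subgraph of `G` and every other ear `Pᵢ` has no chord in `G` except possibly the
chord joining the two endpoints of `Pᵢ`. (A chord of an ear is an edge of `G` joining
two vertices of the ear that are not adjacent along the ear.) -/
def EarDecomposition.IsInducedDecomp {G : SimpleGraph V} (D : EarDecomposition G) : Prop :=
  (∀ x y : V, x ∈ D.earSupport 0 → y ∈ D.earSupport 0 → G.Adj x y →
    s(x, y) ∈ D.earEdges 0) ∧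
  ∀ (i : Fin D.k) (x y : V), x ∈ (D.path i).support → y ∈ (D.path i).support →
    G.Adj x y → (s(x, y) ∈ (D.path i).edges ∨ s(x, y) = s(D.s i, D.t i))

/-- Vertex sets reachable by induced nonseparating long ears, starting at a cycle through `r`. -/
inductive Stage {V : Type u} (G : SimpleGraph V) (r : V) : Set V → Prop
  | cyc {v0 : V} (c : G.Walk v0 v0) (hc : c.IsCycle) (hr : r ∈ c.support)
      (hind : ∀ x y, x ∈ c.support → y ∈ c.support → G.Adj x y → s(x, y) ∈ c.edges)
      (hns : ∀ x ∈ c.support, ∃ y, y ∉ c.support ∧ G.Adj x y) : Stage G r {x | x ∈ c.support}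
  | step {A : Set V} {s t : V} (p : G.Walk s t) (hA : Stage G r A) (hp : p.IsPath)
      (hl : 2 ≤ p.length) (hs : s ∈ A) (ht : t ∈ A)
      (hm : ∀ x ∈ p.support, x ∈ A → x = s ∨ x = t)
      (hind : ∀ x y, x ∈ p.support → y ∈ p.support → G.Adj x y →
        (s(x, y) ∈ p.edges ∨ s(x, y) = s(s, t)))
      (hns : ∀ x ∈ p.support, x ∉ A → ∃ y, y ∉ A ∧ y ∉ p.support ∧ G.Adj x y) :
      Stage G r (A ∪ {x | x ∈ p.support})

theorem walk_split_aux {V : Type u} {G : SimpleGraph V} {s t x y : V} (p : G.Walk s t)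
    (hx : x ∈ p.support) (hy : y ∈ p.support) :
    (∃ (p1 : G.Walk s x) (q : G.Walk x y) (p3 : G.Walk y t), p = p1.append (q.append p3)) ∨
    (∃ (p1 : G.Walk s y) (q : G.Walk y x) (p3 : G.Walk x t), p = p1.append (q.append p3)) := by
  obtain ⟨q, r', rfl⟩ := Walk.mem_support_iff_exists_append.mp hx
  rcases (Walk.mem_support_append_iff _ _).mp hy with h | h
  · obtain ⟨a, b, rfl⟩ := Walk.mem_support_iff_exists_append.mp h
    exact Or.inr ⟨a, b, r', by rw [Walk.append_assoc]⟩
  · obtain ⟨a, b, rfl⟩ := Walk.mem_support_iff_exists_append.mp h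
    exact Or.inl ⟨q, a, b, rfl⟩

theorem stage_path {V : Type u} {G : SimpleGraph V} {r : V} (n : ℕ) :
    ∀ {A : Set V} {s t : V} (p : G.Walk s t), p.length ≤ n → Stage G r A → p.IsPath →
      s ∈ A → t ∈ A → (∀ x ∈ p.support, x ∈ A → x = s ∨ x = t) →
      (∀ x ∈ p.support, x ∉ A → ∃ y, y ∉ A ∧ y ∉ p.support ∧ G.Adj x y) →
      Stage G r (A ∪ {x | x ∈ p.support}) := by
  induction n with
  | zero =>
    intro A s t p hn hA hp hs ht hm hns
    have h0 : p.length = 0 := by omega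
    cases p with
    | nil =>
      have : A ∪ {x | x ∈ (Walk.nil : G.Walk s s).support} = A := by
        ext x; simp; rintro rfl; exact hs
      rw [this]; exact hA
    | cons h q => simp at h0
  | succ n ih =>
    intro A s t p hn hA hp hs ht hm hns
    by_cases hl : 2 ≤ p.length
    swap
    · have : A ∪ {x | x ∈ p.support} = A := by
        ext x
        simp only [Set.mem_union, Set.mem_ofPred_eq, or_iff_left_iff_imp]
        intro hx
        cases p with
        | nil => simp at hx; exact hx ▸ hs
        | cons h q =>
          cases q with
          | nil => simp at hx; rcases hx with rfl | rfl <;> assumption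
          | cons h' q => simp at hl
      rw [this]; exact hA
    by_cases hind : ∀ x y, x ∈ p.support → y ∈ p.support → G.Adj x y →
        (s(x, y) ∈ p.edges ∨ s(x, y) = s(s, t))
    · exact Stage.step p hA hp hl hs ht hm hind hns
    have key : ∃ x y, ∃ (p1 : G.Walk s x) (q : G.Walk x y) (p3 : G.Walk y t),
        p = p1.append (q.append p3) ∧ G.Adj x y ∧ s(x, y) ∉ p.edges ∧ s(x, y) ≠ s(s, t) := by
      push Not at hind
      obtain ⟨x, y, hx, hy, hxy, h1, h2⟩ := hind
      rcases walk_split_aux p hx hy with ⟨p1, q, p3, h⟩ | ⟨p1, q, p3, h⟩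
      · exact ⟨x, y, p1, q, p3, h, hxy, h1, h2⟩
      · exact ⟨y, x, p1, q, p3, h, hxy.symm, by rwa [Sym2.eq_swap], by rwa [Sym2.eq_swap]⟩
    obtain ⟨x, y, p1, q, p3, rfl, hxy, he, hne⟩ := key
    have hq2 : 2 ≤ q.length := by
      cases q with
      | nil => exact absurd rfl hxy.ne
      | cons h q' =>
        cases q' with
        | nil => simp at he
        | cons h' q'' => simp
    have hp13 : 1 ≤ p1.length + p3.length := by
      by_contra hcon
      have h1 : p1.length = 0 := by omega
      have h3 : p3.length = 0 := by omega
      have e1 := Walk.eq_of_length_eq_zero h1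
      have e3 := Walk.eq_of_length_eq_zero h3
      subst e1 e3
      exact hne rfl
    have hnd := (Walk.isPath_def _).mp hp
    have hqp : q.IsPath := hp.of_append_right.of_append_left
    have hp1p : p1.IsPath := hp.of_append_left
    have hp3p : p3.IsPath := hp.of_append_right.of_append_right
    have d1 : ∀ z ∈ p1.support, z ∈ q.support → z = x := by
      intro z hz1 hz2
      by_contra hzx
      exact hp.ne_of_mem_support_of_append hzx hz1
        ((Walk.mem_support_append_iff _ _).2 (Or.inl hz2)) rfl
    have d3 : ∀ z ∈ q.support, z ∈ p3.support → z = y := by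
      intro z hz1 hz2
      by_contra hzx
      exact hp.of_append_right.ne_of_mem_support_of_append hzx hz1 hz2 rfl
    have d13 : ∀ z ∈ p1.support, z ∉ p3.support := by
      intro z hz1 hz2
      by_cases hzx : z = x
      · subst hzx
        exact hxy.ne (d3 _ q.start_mem_support hz2)
      exact hp.ne_of_mem_support_of_append hzx hz1
        ((Walk.mem_support_append_iff _ _).2 (Or.inr hz2)) rfl
    let p' : G.Walk s t := p1.append (Walk.cons hxy p3)
    have hsup' : ∀ z, z ∈ p'.support ↔ z ∈ p1.support ∨ z ∈ p3.support := by
      intro z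
      simp only [p', Walk.mem_support_append_iff, Walk.support_cons, List.mem_cons]
      have : x ∈ p1.support := p1.end_mem_support
      grind
    have hsup : ∀ z, z ∈ (p1.append (q.append p3)).support ↔ 
        z ∈ p1.support ∨ z ∈ q.support ∨ z ∈ p3.support := by
      intro z
      simp only [Walk.mem_support_append_iff]
    have hp' : p'.IsPath := by
      rw [Walk.isPath_def]
      simp only [p', Walk.support_append, Walk.support_cons, List.tail_cons]
      rw [List.nodup_append]
      refine ⟨(Walk.isPath_def _).mp hp1p, (Walk.isPath_def _).mp hp3p, ?_⟩
      intro a ha b hb hab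
      exact d13 a ha (hab ▸ hb)
    simp only [Walk.length_append] at hn
    have hxp : x ∈ p1.support := p1.end_mem_support
    have hyp : y ∈ p3.support := p3.start_mem_support
    have S1 : Stage G r (A ∪ {z | z ∈ p'.support}) := by
      apply ih p' _ hA hp' hs ht
      · intro z hz hzA
        exact hm z (by rw [hsup]; rw [hsup'] at hz; tauto) hzA
      · intro z hz hzA
        obtain ⟨w, h1, h2, h3⟩ := hns z (by rw [hsup]; rw [hsup'] at hz; tauto) hzA
        exact ⟨w, h1, by rw [hsup']; rw [hsup] at h2; tauto, h3⟩
      · simp [p']; omega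
    have S2 := ih q (by omega) S1 hqp (Or.inr ((hsup' _).2 (Or.inl hxp)))
      (Or.inr ((hsup' _).2 (Or.inr hyp))) (by
        intro z hz hzA
        rcases hzA with hzA | hzA
        · have hsp : s ∈ p1.support := p1.start_mem_support
          have htp : t ∈ p3.support := p3.end_mem_support
          rcases hm z (by rw [hsup]; tauto) hzA with rfl | rfl
          · exact Or.inl (d1 _ hsp hz)
          · exact Or.inr (d3 _ hz htp)
        · rcases (hsup' _).1 hzA with h | h
          · exact Or.inl (d1 _ h hz)
          · exact Or.inr (d3 _ hz h)) (by
        intro z hz hzA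
        obtain ⟨w, h1, h2, h3⟩ := hns z (by rw [hsup]; tauto) (fun h => hzA (Or.inl h))
        rw [hsup] at h2
        refine ⟨w, ?_, by tauto, h3⟩
        simp only [Set.mem_union, Set.mem_ofPred_eq, hsup']
        tauto)
    convert S2 using 1
    ext z
    simp only [Set.mem_union, Set.mem_ofPred_eq, hsup', hsup]
    tauto

theorem stage_cycle {V : Type u} {G : SimpleGraph V} {r : V} (n : ℕ) :
    ∀ {v0 : V} (c : G.Walk v0 v0), c.length ≤ n → c.IsCycle → r ∈ c.support →
      (∀ x ∈ c.support, ∃ y, y ∉ c.support ∧ G.Adj x y) →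
      Stage G r {x | x ∈ c.support} := by
  classical
  induction n with
  | zero =>
    intro v0 c hn hc
    have := hc.three_le_length
    omega
  | succ n ih =>
    intro v0 c hn hc hr hns
    by_cases hind : ∀ x y, x ∈ c.support → y ∈ c.support → G.Adj x y → s(x, y) ∈ c.edges
    · exact Stage.cyc c hc hr hind hns
    push Not at hind
    obtain ⟨x, y, hx, hy, hxy, he⟩ := hind
    -- the two arcs
    have key : ∀ (x y : V) (q1 : G.Walk x y) (q2 : G.Walk y x), G.Adj x y →
        (q1.append q2).IsCycle → s(x, y) ∉ (q1.append q2).edges →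
        (q1.append q2).length ≤ n + 1 → r ∈ q1.support →
        (∀ z ∈ (q1.append q2).support, ∃ y, y ∉ (q1.append q2).support ∧ G.Adj z y) →
        Stage G r {z | z ∈ (q1.append q2).support} := by
      intro x y q1 q2 hxy hc he hn hr hns
      have h1 : 2 ≤ q1.length := by
        cases q1 with
        | nil => exact absurd rfl hxy.ne
        | cons h q' =>
          cases q' with
          | nil => simp at he
          | cons h' q'' => simp
      have h2 : 2 ≤ q2.length := by
        cases q2 with
        | nil => exact absurd rfl hxy.ne
        | cons h q' =>
          cases q' with
          | nil => simp [Sym2.eq_swap] at he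
          | cons h' q'' => simp
      simp only [Walk.length_append] at hn
      have hq1 : q1.IsPath := hc.isPath_of_append_left (by
        intro h; rw [← Walk.length_eq_zero_iff] at h; omega)
      have hq2 : q2.IsPath := hc.isPath_of_append_right (by
        intro h; rw [← Walk.length_eq_zero_iff] at h; omega)
      have d : ∀ z ∈ q1.support, z ∈ q2.support → z = y ∨ z = x := by
        intro z hz1 hz2
        by_contra hcon
        push Not at hcon
        have hnd := hc.support_nodup
        rw [Walk.tail_support_append, List.nodup_append] at hnd
        exact hnd.2.2 z (((Walk.mem_support_iff _).1 hz1).resolve_left hcon.2) z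
          (((Walk.mem_support_iff _).1 hz2).resolve_left hcon.1) rfl
      have hC : (Walk.cons hxy.symm q1).IsCycle := by
        rw [Walk.cons_isCycle_iff]
        refine ⟨hq1, ?_⟩
        rw [Sym2.eq_swap]
        intro h
        apply he
        simp [h]
      have hCs : ∀ z, z ∈ (Walk.cons hxy.symm q1).support ↔ z ∈ q1.support := by
        intro z
        have : y ∈ q1.support := q1.end_mem_support
        simp; grind
      have S1 : Stage G r {z | z ∈ (Walk.cons hxy.symm q1).support} := by
        apply ih _ _ hC ((hCs _).2 hr)
        · intro z hz
          rw [hCs] at hz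
          obtain ⟨w, hw, hw'⟩ := hns z (by rw [Walk.mem_support_append_iff]; tauto)
          rw [Walk.mem_support_append_iff] at hw
          exact ⟨w, by rw [hCs]; tauto, hw'⟩
        · simp; omega
      have S2 := stage_path _ q2 le_rfl S1 hq2 ((hCs _).2 q1.end_mem_support)
        ((hCs _).2 q1.start_mem_support) (fun z hz hz' => d z ((hCs _).1 hz') hz) (by
          intro z hz _
          obtain ⟨w, hw, hw'⟩ := hns z (by rw [Walk.mem_support_append_iff]; tauto)
          rw [Walk.mem_support_append_iff] at hw
          refine ⟨w, ?_, by tauto, hw'⟩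
          rw [Set.mem_ofPred_eq, hCs]; tauto)
      convert S2 using 1
      ext z
      simp only [Set.mem_union, Set.mem_ofPred_eq, hCs, Walk.mem_support_append_iff]
    let c' := c.rotate x hx
    have hc' : c'.IsCycle := hc.rotate hx
    have hmem : ∀ z, z ∈ c'.support ↔ z ∈ c.support := fun z => Walk.mem_support_rotate_iff c x hx
    have hedge : ∀ e, e ∈ c'.edges ↔ e ∈ c.edges := fun e => (Walk.rotate_edges c x hx).mem_iff
    have hlen : c'.length = c.length := by simp [c']
    have hset : {z | z ∈ c.support} = {z | z ∈ c'.support} := by ext z; simp [hmem]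
    rw [hset]
    have hy' : y ∈ c'.support := (hmem y).2 hy
    have hr' : r ∈ c'.support := (hmem r).2 hr
    have he' : s(x, y) ∉ c'.edges := fun h => he ((hedge _).1 h)
    have hns' : ∀ z ∈ c'.support, ∃ y, y ∉ c'.support ∧ G.Adj z y := by
      intro z hz
      obtain ⟨w, hw, h⟩ := hns z ((hmem z).1 hz)
      exact ⟨w, fun h' => hw ((hmem w).1 h'), h⟩
    rw [← hlen] at hn
    clear_value c'
    obtain ⟨q1, q2, rfl⟩ := Walk.mem_support_iff_exists_append.mp hy'
    rcases (Walk.mem_support_append_iff _ _).mp hr' with h | h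
    · exact key x y q1 q2 hxy hc' he' hn h hns'
    · have hs2 : ∀ z, z ∈ (q2.append q1).support ↔ z ∈ (q1.append q2).support := by
        intro z; simp only [Walk.mem_support_append_iff]; tauto
      have hc2 : (q2.append q1).IsCycle := by
        rw [Walk.isCycle_def] at hc' ⊢
        obtain ⟨h1, h2, h3⟩ := hc'
        refine ⟨?_, ?_, ?_⟩
        · rw [Walk.isTrail_def, Walk.edges_append] at h1 ⊢
          exact List.nodup_append_comm.mp h1
        · intro h
          have hl := congrArg Walk.length h
          simp only [Walk.length_append, Walk.length_nil] at hl
          exact hxy.ne (Walk.eq_of_length_eq_zero (p := q1) (by omega))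
        · rw [Walk.tail_support_append] at h3 ⊢
          exact List.nodup_append_comm.mp h3
      have := key y x q2 q1 hxy.symm hc2 (by
        rw [Sym2.eq_swap]; simpa [or_comm] using he') (by
        simp only [Walk.length_append] at hn ⊢; omega) h (by simpa only [hs2] using hns')
      simpa only [hs2] using this

/-- An ear, as a walk with its endpoints. -/
structure MEar {V : Type u} (G : SimpleGraph V) where
  /-- first endpoint -/
  s : V
  /-- second endpoint -/
  t : V
  /-- the walk -/
  w : G.Walk s t

/-- vertices of the cycle and the first `i` ears -/
def MVS {V : Type u} {G : SimpleGraph V} {v0 : V} (c : G.Walk v0 v0) (f : ℕ → MEar G) (i : ℕ) :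
    Set V := {x | x ∈ c.support ∨ ∃ j, j < i ∧ x ∈ (f j).w.support}

/-- an induced nonseparating sequence of ears, not necessarily covering all edges -/
structure SeqOK {V : Type u} {G : SimpleGraph V} (r : V) {v0 : V} (c : G.Walk v0 v0) (k : ℕ)
    (f : ℕ → MEar G) : Prop where
  cyc : c.IsCycle
  hr : r ∈ c.support
  ind0 : ∀ x y, x ∈ c.support → y ∈ c.support → G.Adj x y → s(x, y) ∈ c.edges
  ns0 : ∀ x ∈ c.support, ∃ y, y ∉ c.support ∧ G.Adj x y
  isPath : ∀ i < k, (f i).w.IsPath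
  pos : ∀ i < k, 0 < (f i).w.length
  cpd : ∀ i < k, ∀ e ∈ (f i).w.edges, e ∉ c.edges
  ppd : ∀ i j, i < j → j < k → ∀ e ∈ (f j).w.edges, e ∉ (f i).w.edges
  meets : ∀ i < k, ∀ x ∈ (f i).w.support, (x ∈ MVS c f i ↔ x = (f i).s ∨ x = (f i).t)
  ind : ∀ i < k, ∀ x y, x ∈ (f i).w.support → y ∈ (f i).w.support → G.Adj x y →
    (s(x, y) ∈ (f i).w.edges ∨ s(x, y) = s((f i).s, (f i).t))
  ns : ∀ i < k, (∃ y, y ∉ MVS c f (i + 1)) → ∀ x ∈ (f i).w.support, x ≠ (f i).s → x ≠ (f i).t →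
    ∃ y, y ∉ MVS c f (i + 1) ∧ G.Adj x y

theorem MVS_update {V : Type u} {G : SimpleGraph V} {v0 : V} (c : G.Walk v0 v0) (f : ℕ → MEar G)
    (k : ℕ) (e : MEar G) (i : ℕ) (hi : i ≤ k) : MVS c (Function.update f k e) i = MVS c f i := by
  ext x
  simp only [MVS, Set.mem_ofPred_eq]
  have : ∀ j, j < i → Function.update f k e j = f j := fun j hj =>
    Function.update_of_ne (by omega) _ _
  constructor
  · rintro (h | ⟨j, hj, h⟩)
    · exact Or.inl h
    · rw [this j hj] at h
      exact Or.inr ⟨j, hj, h⟩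
  · rintro (h | ⟨j, hj, h⟩)
    · exact Or.inl h
    · rw [← this j hj] at h
      exact Or.inr ⟨j, hj, h⟩

theorem MVS_succ {V : Type u} {G : SimpleGraph V} {v0 : V} (c : G.Walk v0 v0) (f : ℕ → MEar G)
    (k : ℕ) : MVS c f (k + 1) = MVS c f k ∪ {x | x ∈ (f k).w.support} := by
  ext x
  simp only [MVS, Set.mem_ofPred_eq, Set.mem_union]
  constructor
  · rintro (h | ⟨j, hj, h⟩)
    · exact Or.inl (Or.inl h)
    · rcases Nat.lt_succ_iff_lt_or_eq.mp hj with hj | rfl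
      · exact Or.inl (Or.inr ⟨j, hj, h⟩)
      · exact Or.inr h
  · rintro ((h | ⟨j, hj, h⟩) | h)
    · exact Or.inl h
    · exact Or.inr ⟨j, by omega, h⟩
    · exact Or.inr ⟨k, by omega, h⟩

theorem SeqOK.snoc {V : Type u} {G : SimpleGraph V} {r : V} {v0 : V} {c : G.Walk v0 v0} {k : ℕ}
    {f : ℕ → MEar G} (h : SeqOK r c k f) (e : MEar G) (hp : e.w.IsPath) (hpos : 0 < e.w.length)
    (hc : ∀ x ∈ e.w.edges, x ∉ c.edges) (hf : ∀ i < k, ∀ x ∈ e.w.edges, x ∉ (f i).w.edges)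
    (hm : ∀ x ∈ e.w.support, (x ∈ MVS c f k ↔ x = e.s ∨ x = e.t))
    (hind : ∀ x y, x ∈ e.w.support → y ∈ e.w.support → G.Adj x y →
      (s(x, y) ∈ e.w.edges ∨ s(x, y) = s(e.s, e.t)))
    (hns : (∃ y, y ∉ MVS c f k ∪ {x | x ∈ e.w.support}) →
      ∀ x ∈ e.w.support, x ≠ e.s → x ≠ e.t →
      ∃ y, y ∉ MVS c f k ∪ {x | x ∈ e.w.support} ∧ G.Adj x y) :
    SeqOK r c (k + 1) (Function.update f k e) := by
  have e1 : ∀ i, i < k → Function.update f k e i = f i := fun i hi =>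
    Function.update_of_ne (by omega) _ _
  have e2 : Function.update f k e k = e := Function.update_self _ _ _
  have cases : ∀ (P : ℕ → MEar G → Prop), (∀ i < k, P i (f i)) → P k e →
      ∀ i < k + 1, P i (Function.update f k e i) := by
    intro P h1 h2 i hi
    rcases Nat.lt_succ_iff_lt_or_eq.mp hi with hi | rfl
    · rw [e1 i hi]; exact h1 i hi
    · rw [e2]; exact h2
  refine ⟨h.cyc, h.hr, h.ind0, h.ns0, ?_, ?_, ?_, ?_, ?_, ?_, ?_⟩
  · exact cases (fun _ e => e.w.IsPath) h.isPath hp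
  · exact cases (fun _ e => 0 < e.w.length) h.pos hpos
  · exact cases (fun _ e => ∀ x ∈ e.w.edges, x ∉ c.edges) h.cpd hc
  · intro i j hij hj
    rw [e1 i (by omega)]
    rcases Nat.lt_succ_iff_lt_or_eq.mp hj with hj | rfl
    · rw [e1 j hj]; exact h.ppd i j hij hj
    · rw [e2]; exact hf i hij
  · intro i hi
    rw [MVS_update _ _ _ _ _ (by omega)]
    revert i
    exact cases (fun i e => ∀ x ∈ e.w.support, (x ∈ MVS c f i ↔ x = e.s ∨ x = e.t)) h.meets hm
  · exact cases (fun i e => ∀ x y, x ∈ e.w.support → y ∈ e.w.support → G.Adj x y →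
      (s(x, y) ∈ e.w.edges ∨ s(x, y) = s(e.s, e.t))) h.ind hind
  · intro i hi
    rw [MVS_succ, MVS_update _ _ _ _ _ (by omega)]
    revert i
    refine cases (fun i e => (∃ y, y ∉ MVS c f i ∪ {x | x ∈ e.w.support}) →
      ∀ x ∈ e.w.support, x ≠ e.s → x ≠ e.t →
      ∃ y, y ∉ MVS c f i ∪ {x | x ∈ e.w.support} ∧ G.Adj x y) ?_ hns
    intro i hi
    rw [← MVS_succ]
    exact h.ns i hi

theorem SeqOK.edge_mem {V : Type u} {G : SimpleGraph V} {v0 : V} {c : G.Walk v0 v0} {k : ℕ}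
    {f : ℕ → MEar G} {x y : V}
    (h : s(x, y) ∈ c.edges ∨ ∃ i, i < k ∧ s(x, y) ∈ (f i).w.edges) :
    x ∈ MVS c f k ∧ y ∈ MVS c f k := by
  rcases h with h | ⟨i, hi, h⟩
  · exact ⟨Or.inl (Walk.fst_mem_support_of_mem_edges _ h),
      Or.inl (Walk.snd_mem_support_of_mem_edges _ h)⟩
  · exact ⟨Or.inr ⟨i, hi, Walk.fst_mem_support_of_mem_edges _ h⟩,
      Or.inr ⟨i, hi, Walk.snd_mem_support_of_mem_edges _ h⟩⟩

/-- an edge of a long ear is never among edges of the earlier ears -/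
theorem long_edge_new {V : Type u} {G : SimpleGraph V} {v0 : V} {c : G.Walk v0 v0} {k : ℕ}
    {f : ℕ → MEar G} {s t : V} (p : G.Walk s t) (hp : p.IsPath) (hl : 2 ≤ p.length)
    (hm : ∀ x ∈ p.support, x ∈ MVS c f k → x = s ∨ x = t) (e : Sym2 V) (he : e ∈ p.edges) :
    ¬ (e ∈ c.edges ∨ ∃ i, i < k ∧ e ∈ (f i).w.edges) := by
  induction e with | _ x y
  intro h
  obtain ⟨hx, hy⟩ := SeqOK.edge_mem h
  have hne := (p.adj_of_mem_edges he).ne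
  have hst : s(x, y) = s(s, t) := by
    rcases hm x (Walk.fst_mem_support_of_mem_edges _ he) hx with h1 | h1 <;>
    rcases hm y (Walk.snd_mem_support_of_mem_edges _ he) hy with h2 | h2
    · exact absurd (h1.trans h2.symm) hne
    · rw [h1, h2]
    · rw [h1, h2, Sym2.eq_swap]
    · exact absurd (h1.trans h2.symm) hne
  rw [hst] at he
  have := hp.length_eq_one_of_mem_edges he
  omega

theorem Stage.toSeq {V : Type u} {G : SimpleGraph V} {r : V} {A : Set V} (h : Stage G r A) :
    ∃ (v0 : V) (c : G.Walk v0 v0) (k : ℕ) (f : ℕ → MEar G), SeqOK r c k f ∧ MVS c f k = A := by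
  induction h with
  | @cyc v0 c hc hr hind hns =>
    refine ⟨v0, c, 0, fun _ => ⟨v0, v0, Walk.nil⟩, ⟨hc, hr, hind, hns, ?_, ?_, ?_, ?_, ?_, ?_, ?_⟩, ?_⟩
    all_goals first | (intro i hi; omega) | skip
    ext x; simp [MVS]
  | @step A s t p hA hp hl hs ht hm hind hns ih =>
    obtain ⟨v0, c, k, f, hok, rfl⟩ := ih
    refine ⟨v0, c, k + 1, Function.update f k ⟨s, t, p⟩, hok.snoc ⟨s, t, p⟩ hp ?_ ?_ ?_ ?_ hind ?_, ?_⟩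
    · simp only; omega
    · intro e he h
      exact long_edge_new p hp hl hm e he (Or.inl h)
    · intro i hi e he h
      exact long_edge_new p hp hl hm e he (Or.inr ⟨i, hi, h⟩)
    · intro x hx
      refine ⟨hm x hx, ?_⟩
      rintro (rfl | rfl) <;> assumption
    · rintro - x hx hxs hxt
      obtain ⟨y, h1, h2, h3⟩ := hns x hx (fun h => (hm x hx h).elim hxs hxt)
      exact ⟨y, by simp [h1, h2], h3⟩
    · rw [MVS_succ, MVS_update _ _ _ _ _ le_rfl, Function.update_self]

/-- a sequence whose last long ear has index `m` and is the ear of `u` -/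
structure SeqFin {V : Type u} {G : SimpleGraph V} (r u : V) {v0 : V} (c : G.Walk v0 v0) (k m : ℕ)
    (f : ℕ → MEar G) : Prop where
  ok : SeqOK r c k f
  hmk : m < k
  vs : MVS c f m = {u}ᶜ
  inner : ∀ x, (x ∈ (f m).w.support ∧ x ≠ (f m).s ∧ x ≠ (f m).t) ↔ x = u
  long : 2 ≤ (f m).w.length
  short : ∀ i < k, m < i → (f i).w.length = 1
  avoid : s(r, u) ∉ (f m).w.edges

theorem Stage.toFin {V : Type u} {G : SimpleGraph V} {r u a b : V} (h : Stage G r {u}ᶜ)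
    (hab : a ≠ b) (ha : G.Adj u a) (hb : G.Adj u b) (har : a ≠ r) (hbr : b ≠ r) :
    ∃ (v0 : V) (c : G.Walk v0 v0) (m : ℕ) (f : ℕ → MEar G), SeqFin r u c (m + 1) m f := by
  obtain ⟨v0, c, k, f, hok, hA⟩ := h.toSeq
  let p : G.Walk a b := Walk.cons ha.symm (Walk.cons hb Walk.nil)
  have hp : p.IsPath := by
    rw [Walk.isPath_def]
    simp [p, ha.ne', hb.ne, hab]
  have hl : 2 ≤ p.length := by simp [p]
  have hsup : ∀ x, x ∈ p.support ↔ x = a ∨ x = u ∨ x = b := by simp [p]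
  have hm : ∀ x ∈ p.support, x ∈ MVS c f k ↔ x = a ∨ x = b := by
    intro x hx
    rw [hA]
    rw [hsup] at hx
    have := ha.ne'
    have := hb.ne'
    simp only [Set.mem_compl_iff, Set.mem_singleton_iff]
    grind
  have hur : r ≠ u := by
    have : r ∈ MVS c f k := Or.inl hok.hr
    rw [hA] at this
    exact this
  refine ⟨v0, c, k, Function.update f k ⟨a, b, p⟩, hok.snoc ⟨a, b, p⟩ hp ?_ ?_ ?_ hm ?_ ?_,
    by omega, ?_, ?_, ?_, ?_, ?_⟩
  · simp only; omega
  · intro e he h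
    exact long_edge_new p hp hl (fun x hx => (hm x hx).1) e he (Or.inl h)
  · intro i hi e he h
    exact long_edge_new p hp hl (fun x hx => (hm x hx).1) e he (Or.inr ⟨i, hi, h⟩)
  · intro x y hx hy hxy
    have hx' := (hsup x).1 hx
    have hy' := (hsup y).1 hy
    have := hxy.ne
    have hed : p.edges = [s(a, u), s(u, b)] := by simp [p]
    simp only [hed, List.mem_cons]
    rcases hx' with rfl | rfl | rfl <;> rcases hy' with rfl | rfl | rfl <;>
      simp [Sym2.eq_swap] at this ⊢
  · rintro ⟨y, hy⟩
    exfalso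
    apply hy
    by_cases h : y = u
    · exact Or.inr ((hsup y).2 (by tauto))
    · left; rw [hA]; exact h
  · rw [MVS_update _ _ _ _ _ le_rfl, hA]
  · intro x
    rw [Function.update_self]
    simp only [hsup]
    have := ha.ne
    have := hb.ne
    grind
  · rw [Function.update_self]; exact hl
  · intro i hi hi'; omega
  · rw [Function.update_self]
    simp only [p, Walk.edges_cons, Walk.edges_nil, List.mem_cons, Sym2.eq_iff]
    grind

theorem SeqFin.cover {V : Type u} {G : SimpleGraph V} {r u : V} {v0 : V} {c : G.Walk v0 v0}
    {m : ℕ} {f : ℕ → MEar G} (h : SeqFin r u c (m + 1) m f) (F : Finset (Sym2 V)) :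
    ∃ (k : ℕ) (f : ℕ → MEar G), SeqFin r u c k m f ∧
      ∀ e ∈ F, e ∈ G.edgeSet → (e ∈ c.edges ∨ ∃ i, i < k ∧ e ∈ (f i).w.edges) := by
  classical
  induction F using Finset.induction_on with
  | empty => exact ⟨m + 1, f, h, by simp⟩
  | insert e F heF ih =>
    obtain ⟨k, f, hf, hcov⟩ := ih
    by_cases he : e ∈ G.edgeSet → (e ∈ c.edges ∨ ∃ i, i < k ∧ e ∈ (f i).w.edges)
    · refine ⟨k, f, hf, ?_⟩
      intro e' he'
      rcases Finset.mem_insert.mp he' with rfl | h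
      · exact he
      · exact hcov e' h
    push Not at he
    obtain ⟨heG, hec, hef⟩ := he
    induction e with | _ x y
    have hxy : G.Adj x y := heG
    have hall : ∀ z, z ∈ MVS c f k := by
      intro z
      by_cases hz : z = u
      · exact Or.inr ⟨m, hf.hmk, ((hf.inner z).2 hz).1⟩
      · have : z ∈ MVS c f m := by rw [hf.vs]; exact hz
        rcases this with h | ⟨j, hj, h⟩
        · exact Or.inl h
        · exact Or.inr ⟨j, hj.trans hf.hmk, h⟩
    let p : G.Walk x y := Walk.cons hxy Walk.nil
    have hsup : ∀ z, z ∈ p.support ↔ z = x ∨ z = y := by simp [p]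
    have hed : ∀ e, e ∈ p.edges ↔ e = s(x, y) := by simp [p]
    have hu : ∀ i, i < k → Function.update f k ⟨x, y, p⟩ i = f i := fun i hi =>
      Function.update_of_ne (by omega) _ _
    refine ⟨k + 1, Function.update f k ⟨x, y, p⟩, ⟨hf.ok.snoc ⟨x, y, p⟩ ?_ ?_ ?_ ?_ ?_ ?_ ?_,
      ?_, ?_, ?_, ?_, ?_, ?_⟩, ?_⟩
    · rw [Walk.isPath_def]; simp [p, hxy.ne]
    · simp [p]
    · intro e he; rw [(hed e).1 he]; exact hec
    · intro i hi e he; rw [(hed e).1 he]; exact hef i hi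
    · intro z hz
      exact ⟨fun _ => (hsup z).1 hz, fun _ => hall z⟩
    · intro a b ha hb hab
      left
      rw [hed]
      have := hab.ne
      rcases (hsup a).1 ha with rfl | rfl <;> rcases (hsup b).1 hb with rfl | rfl <;>
        simp [Sym2.eq_swap] at this ⊢
    · rintro ⟨z, hz⟩
      exact absurd (Or.inl (hall z)) hz
    · have := hf.hmk; omega
    · rw [MVS_update _ _ _ _ _ hf.hmk.le]; exact hf.vs
    · rw [hu m hf.hmk]; exact hf.inner
    · rw [hu m hf.hmk]; exact hf.long
    · intro i hi hmi
      rcases Nat.lt_succ_iff_lt_or_eq.mp hi with hi | rfl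
      · rw [hu i hi]; exact hf.short i hi hmi
      · rw [Function.update_self]; simp [p]
    · rw [hu m hf.hmk]; exact hf.avoid
    · intro e he heG
      rcases Finset.mem_insert.mp he with rfl | he
      · right
        exact ⟨k, by omega, by rw [Function.update_self]; simp [p]⟩
      · rcases hcov e he heG with h | ⟨i, hi, h⟩
        · exact Or.inl h
        · exact Or.inr ⟨i, by omega, by rw [hu i hi]; exact h⟩

theorem mem_Vbar_iff {V : Type u} {G : SimpleGraph V} (D : EarDecomposition G) (i : ℕ) (x : V) :
    x ∈ D.Vbar i ↔ ¬ (x ∈ D.cycle.support ∨ ∃ j : Fin D.k, j.val < i ∧ x ∈ (D.path j).support) := by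
  simp only [EarDecomposition.Vbar, EarDecomposition.partialGraph, Set.mem_compl_iff,
    Subgraph.verts_iSup, Set.mem_iUnion, Finset.mem_range]
  apply not_congr
  constructor
  · rintro ⟨j, hj, h⟩
    unfold EarDecomposition.ear at h
    split_ifs at h with h1 h2
    · exact Or.inl (by simpa using h)
    · exact Or.inr ⟨⟨j - 1, h2⟩, by simp; omega, by simpa using h⟩
    · simp at h
  · rintro (h | ⟨j, hj, h⟩)
    · exact ⟨0, by omega, by simpa [EarDecomposition.ear] using h⟩
    · exact ⟨j.val + 1, by omega, by simpa [EarDecomposition.ear] using h⟩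

theorem SeqFin.toDecomp {V : Type u} [Fintype V] {G : SimpleGraph V} {r u : V} {v0 : V}
    {c : G.Walk v0 v0} {k m : ℕ} {f : ℕ → MEar G} (h : SeqFin r u c k m f)
    (hcov : ∀ e ∈ G.edgeSet, (e ∈ c.edges ∨ ∃ i, i < k ∧ e ∈ (f i).w.edges)) :
    ∃ D' : EarDecomposition G, IsMondshein D' r u ∧ D'.IsInducedDecomp := by
  have hok := h.ok
  let D : EarDecomposition G :=
    { k := k
      v0 := v0
      cycle := c
      cycle_isCycle := hok.cyc
      s := fun i => (f i).s
      t := fun i => (f i).t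
      path := fun i => (f i).w
      path_isPath := fun i => hok.isPath i i.2
      path_length_pos := fun i => hok.pos i i.2
      edges_cover := by
        intro e he
        rcases hcov e he with h | ⟨i, hi, h⟩
        · exact Or.inl h
        · exact Or.inr ⟨⟨i, hi⟩, h⟩
      cycle_path_disjoint := fun i => hok.cpd i i.2
      path_path_disjoint := by
        intro i j hij e he1 he2
        rcases Nat.lt_or_gt_of_ne (fun h => hij (Fin.ext h)) with h | h
        · exact hok.ppd i j h j.2 e he2 he1
        · exact hok.ppd j i h i.2 e he1 he2
      meets_prev := by
        intro i x hx
        rw [← hok.meets i i.2 x hx]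
        simp only [MVS, Set.mem_ofPred_eq]
        constructor
        · rintro (h | ⟨j, hj, h⟩)
          · exact Or.inl h
          · exact Or.inr ⟨j, hj, h⟩
        · rintro (h | ⟨j, hj, h⟩)
          · exact Or.inl h
          · exact Or.inr ⟨⟨j, hj.trans i.2⟩, hj, h⟩ }
  have hV : ∀ i ≤ k, ∀ x, x ∈ D.Vbar i ↔ x ∉ MVS c f i := by
    intro i hi x
    rw [mem_Vbar_iff]
    apply not_congr
    constructor
    · rintro (h | ⟨j, hj, h⟩)
      · exact Or.inl h
      · exact Or.inr ⟨j, hj, h⟩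
    · rintro (h | ⟨j, hj, h⟩)
      · exact Or.inl h
      · exact Or.inr ⟨⟨j, by change j < k; omega⟩, hj, h⟩
  have hes0 : ∀ x, x ∈ D.earSupport 0 ↔ x ∈ c.support := by
    intro x; simp [EarDecomposition.earSupport, EarDecomposition.ear, D]
  have hee0 : ∀ x, x ∈ D.earEdges 0 ↔ x ∈ c.edges := by
    intro x; simp [EarDecomposition.earEdges, EarDecomposition.ear, D]
  have hes : ∀ i < k, ∀ x, x ∈ D.earSupport (i + 1) ↔ x ∈ (f i).w.support := by
    intro i hi x; simp [EarDecomposition.earSupport, EarDecomposition.ear, D, hi]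
  have hee : ∀ i < k, ∀ x, x ∈ D.earEdges (i + 1) ↔ x ∈ (f i).w.edges := by
    intro i hi x; simp [EarDecomposition.earEdges, EarDecomposition.ear, D, hi]
  have hin : ∀ i < k, ∀ x, x ∈ D.inner (i + 1) ↔
      (x ∈ (f i).w.support ∧ x ≠ (f i).s ∧ x ≠ (f i).t) := by
    intro i hi x; simp [EarDecomposition.inner, D, hi]
  have hlong : ∀ i < k, D.IsLong (i + 1) ↔ 2 ≤ (f i).w.length := by
    intro i hi; simp [EarDecomposition.IsLong, D, hi]
  have hmk := h.hmk
  have huu : u ∉ MVS c f m := by rw [h.vs]; simp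
  have hbirth : D.birth u = m + 1 := by
    have hmem : m + 1 ∈ {i | u ∈ D.earSupport i} := by
      rw [Set.mem_ofPred_eq, hes m hmk]
      exact ((h.inner u).2 rfl).1
    apply le_antisymm (Nat.sInf_le hmem)
    apply le_csInf ⟨_, hmem⟩
    intro i hi
    by_contra hcon
    apply huu
    rcases i with _ | i
    · exact Or.inl ((hes0 u).1 hi)
    · exact Or.inr ⟨i, by omega, (hes i (by omega) u).1 hi⟩
  refine ⟨D, ⟨(hes0 r).2 hok.hr, ?_, ?_, ?_, ?_, ?_⟩, ?_, ?_⟩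
  · rw [hbirth, hlong m hmk]; exact h.long
  · rw [hbirth]
    intro j hj hl
    rcases j with _ | j
    · omega
    · have hj' : j < k := hj
      rw [hlong j hj'] at hl
      by_contra hcon
      have := h.short j hj' (by omega)
      omega
  · rw [hbirth]
    ext x
    rw [hin m hmk, h.inner]; rfl
  · rw [hbirth, hee m hmk]; exact h.avoid
  · intro i hi hne x hx
    rcases i with _ | i
    · obtain ⟨y, hy, hxy⟩ := hok.ns0 x ((hes0 x).1 (by simpa [EarDecomposition.inner] using hx))
      refine ⟨y, ?_, hxy⟩
      rw [hV 0 hi]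
      simp [MVS, hy]
    · have hi' : i < k := hi
      obtain ⟨z, hz⟩ := hne
      rw [hV _ hi] at hz
      rw [hin i hi'] at hx
      obtain ⟨y, hy, hxy⟩ := hok.ns i hi' ⟨z, hz⟩ x hx.1 hx.2.1 hx.2.2
      exact ⟨y, (hV _ hi y).2 hy, hxy⟩
  · intro x y hx hy hxy
    rw [hee0]
    exact hok.ind0 x y ((hes0 x).1 hx) ((hes0 y).1 hy) hxy
  · intro i x y hx hy hxy
    exact hok.ind i i.2 x y hx hy hxy

theorem Stage.final {V : Type u} [Fintype V] {G : SimpleGraph V} {r u a b : V}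
    (h : Stage G r {u}ᶜ)
    (hab : a ≠ b) (ha : G.Adj u a) (hb : G.Adj u b) (har : a ≠ r) (hbr : b ≠ r) :
    ∃ D' : EarDecomposition G, IsMondshein D' r u ∧ D'.IsInducedDecomp := by
  classical
  obtain ⟨v0, c, m, f, hf⟩ := h.toFin hab ha hb har hbr
  obtain ⟨k, f', hf', hcov⟩ := hf.cover Finset.univ
  exact hf'.toDecomp (fun e he => hcov e (Finset.mem_univ _) he)

theorem short_support {V : Type u} {G : SimpleGraph V} {s t x : V} (p : G.Walk s t)
    (hl : ¬ 2 ≤ p.length) (hx : x ∈ p.support) : x = s ∨ x = t := by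
  cases p with
  | nil => simp at hx; exact Or.inl hx
  | cons h q =>
    cases q with
    | nil => simpa using hx
    | cons h' q => simp at hl

theorem last_ear {V : Type u} {G : SimpleGraph V} {r u s t : V} (p : G.Walk s t)
    (hp : p.IsPath) (hl : 2 ≤ p.length)
    (hin : ∀ x, (x ∈ p.support ∧ x ≠ s ∧ x ≠ t) ↔ x = u) (hav : s(r, u) ∉ p.edges) :
    ∃ a b, a ≠ b ∧ G.Adj u a ∧ G.Adj u b ∧ a ≠ r ∧ b ≠ r := by
  cases p with
  | nil => simp at hl
  | @cons _ x _ h q =>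
    cases q with
    | nil => simp at hl
    | @cons _ y _ h' q =>
      have hnd := (Walk.isPath_def _).mp hp
      simp only [Walk.support_cons, List.nodup_cons, List.mem_cons, not_or] at hnd
      have ht := q.end_mem_support
      have hy := q.start_mem_support
      have hxt : x ≠ t := by rintro rfl; exact hnd.2.1 ht
      have hxu : x = u := (hin x).1 ⟨by simp, h.ne', hxt⟩
      subst hxu
      have hys : s ≠ y := by rintro rfl; exact hnd.1.2 hy
      refine ⟨s, y, hys, h.symm, h', ?_, ?_⟩
      · rintro rfl; simp at hav
      · rintro rfl; simp [Sym2.eq_swap] at hav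

/-- From a Mondshein sequence, an induced one. -/
theorem mondshein_induced {V : Type u} [Fintype V] {G : SimpleGraph V} {r u : V}
    (D : EarDecomposition G) (hD : IsMondshein D r u) :
    ∃ D' : EarDecomposition G, IsMondshein D' r u ∧ D'.IsInducedDecomp := by
  obtain ⟨hr, hlong, hlast, hinner, havoid, hns⟩ := hD
  have hr' : r ∈ D.cycle.support := by
    simpa [EarDecomposition.earSupport, EarDecomposition.ear] using hr
  have hbne : D.birth u ≠ 0 := by
    intro h0
    rw [h0] at hinner
    have h0' : ∀ x ∈ D.cycle.support, x = u := by
      intro x hx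
      have : x ∈ D.inner 0 := by
        simpa [EarDecomposition.inner, EarDecomposition.earSupport, EarDecomposition.ear] using hx
      rw [hinner] at this
      exact this
    have hc := D.cycle_isCycle
    have h1 := h0' _ D.cycle.start_mem_support
    have h2 := h0' _ (D.cycle.getVert_mem_support 1)
    exact (D.cycle.adj_snd hc.not_nil).ne (h1.trans h2.symm)
  obtain ⟨m, hm⟩ : ∃ m, D.birth u = m + 1 := ⟨D.birth u - 1, by omega⟩
  rw [hm] at hlong hlast hinner havoid
  obtain ⟨hmk, hml⟩ : ∃ h : m < D.k, 2 ≤ (D.path ⟨m, h⟩).length := by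
    rcases hlong with h | ⟨h, h'⟩
    · omega
    · exact ⟨h, h'⟩
  have hinner' : ∀ x, (x ∈ (D.path ⟨m, hmk⟩).support ∧ x ≠ D.s ⟨m, hmk⟩ ∧ x ≠ D.t ⟨m, hmk⟩) ↔
      x = u := by
    intro x
    have : x ∈ D.inner (m + 1) ↔ x = u := by rw [hinner]; rfl
    rw [← this]
    simp [EarDecomposition.inner, hmk]
  let W : ℕ → Set V := fun i =>
    {x | x ∈ D.cycle.support ∨ ∃ j : Fin D.k, j.val < i ∧ x ∈ (D.path j).support}
  have hW : ∀ i x, x ∈ D.Vbar i ↔ x ∉ W i := fun i x => mem_Vbar_iff D i x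
  have hWsucc : ∀ i (hi : i < D.k), W (i + 1) = W i ∪ {x | x ∈ (D.path ⟨i, hi⟩).support} := by
    intro i hi
    ext x
    simp only [W, Set.mem_ofPred_eq, Set.mem_union]
    constructor
    · rintro (h | ⟨j, hj, h⟩)
      · exact Or.inl (Or.inl h)
      · rcases Nat.lt_succ_iff_lt_or_eq.mp hj with hj | rfl
        · exact Or.inl (Or.inr ⟨j, hj, h⟩)
        · exact Or.inr h
    · rintro ((h | ⟨j, hj, h⟩) | h)
      · exact Or.inl h
      · exact Or.inr ⟨j, by omega, h⟩
      · exact Or.inr ⟨⟨i, hi⟩, by simp, h⟩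
  have humem := (hinner' u).2 rfl
  have hmeet : ∀ i (hi : i < D.k), ∀ x ∈ (D.path ⟨i, hi⟩).support,
      (x ∈ W i ↔ x = D.s ⟨i, hi⟩ ∨ x = D.t ⟨i, hi⟩) := by
    intro i hi x hx
    exact D.meets_prev ⟨i, hi⟩ x hx
  have huW : u ∉ W m := by
    intro h
    rcases (hmeet m hmk u humem.1).1 h with h | h
    · exact humem.2.1 h
    · exact humem.2.2 h
  have hmono : ∀ i j, i ≤ j → W i ⊆ W j := by
    rintro i j hij x (h | ⟨l, hl, h⟩)
    · exact Or.inl h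
    · exact Or.inr ⟨l, by omega, h⟩
  have hst : ∀ i (hi : i < D.k), D.s ⟨i, hi⟩ ∈ W i ∧ D.t ⟨i, hi⟩ ∈ W i := fun i hi =>
    ⟨(hmeet i hi _ (Walk.start_mem_support _)).2 (Or.inl rfl),
      (hmeet i hi _ (Walk.end_mem_support _)).2 (Or.inr rfl)⟩
  have hstage : ∀ i, i ≤ m → Stage G r (W i) := by
    intro i
    induction i with
    | zero =>
      intro _
      have hW0 : W 0 = {x | x ∈ D.cycle.support} := by ext x; simp [W]
      rw [hW0]
      refine stage_cycle _ D.cycle le_rfl D.cycle_isCycle hr' ?_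
      intro x hx
      obtain ⟨y, hy, hxy⟩ := hns 0 (by omega) ⟨u, by
        rw [hW]; exact fun h => huW (hmono 0 m (by omega) h)⟩ x (by
        simpa [EarDecomposition.inner, EarDecomposition.earSupport, EarDecomposition.ear] using hx)
      rw [hW, hW0] at hy
      exact ⟨y, hy, hxy⟩
    | succ i ih =>
      intro hi
      have hik : i < D.k := by omega
      rw [hWsucc i hik]
      refine stage_path _ (D.path ⟨i, hik⟩) le_rfl (ih (by omega)) (D.path_isPath _)
        (hst i hik).1 (hst i hik).2 (fun x hx => (hmeet i hik x hx).1) ?_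
      intro x hx hxW
      obtain ⟨y, hy, hxy⟩ := hns (i + 1) (by omega) ⟨u, by
        rw [hW]; exact fun h => huW (hmono _ m (by omega) h)⟩ x (by
        have := hmeet i hik x hx
        simp [EarDecomposition.inner, hik]
        tauto)
      rw [hW, hWsucc i hik] at hy
      simp only [Set.mem_union, Set.mem_ofPred_eq, not_or] at hy
      exact ⟨y, hy.1, hy.2, hxy⟩
  have hshort : ∀ i, m + 1 ≤ i → i ≤ D.k → W i = W (m + 1) := by
    intro i hi
    induction i, hi using Nat.le_induction with
    | base => intro _; rfl
    | succ i hi ih =>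
      intro hik
      have hik' : i < D.k := by omega
      rw [← ih (by omega), hWsucc i hik', Set.union_eq_left]
      intro x hx
      have hnl : ¬ 2 ≤ (D.path ⟨i, hik'⟩).length := by
        intro h
        have := hlast (i + 1) hik (Or.inr ⟨hik', h⟩)
        omega
      have hs' := hst i hik'
      rcases short_support _ hnl hx with h | h <;> rw [h]
      exacts [hs'.1, hs'.2]
  have hall : ∀ x, x ∈ W (m + 1) := by
    by_contra hcon
    push Not at hcon
    obtain ⟨z, hz⟩ := hcon
    obtain ⟨y, hy, huy⟩ := hns (m + 1) hmk ⟨z, (hW _ _).2 hz⟩ u (by rw [hinner]; rfl)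
    rw [hW] at hy
    apply hy
    rw [← hshort D.k hmk le_rfl]
    rcases D.edges_cover s(u, y) huy with h | ⟨i, h⟩
    · exact Or.inl (Walk.snd_mem_support_of_mem_edges _ h)
    · exact Or.inr ⟨i, i.2, Walk.snd_mem_support_of_mem_edges _ h⟩
  have hWm : W m = {u}ᶜ := by
    ext x
    simp only [Set.mem_compl_iff, Set.mem_singleton_iff]
    constructor
    · rintro h rfl; exact huW h
    · intro hx
      have := hall x
      rw [hWsucc m hmk] at this
      rcases this with h | h
      · exact h
      · have h2 := (not_congr (hinner' x)).2 hx
        rw [hmeet m hmk x h]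
        have h : x ∈ (D.path ⟨m, hmk⟩).support := h
        tauto
  have hS := hstage m le_rfl
  rw [hWm] at hS
  have havoid' : s(r, u) ∉ (D.path ⟨m, hmk⟩).edges := by
    simpa [EarDecomposition.earEdges, EarDecomposition.ear, hmk] using havoid
  have hpp := D.path_isPath ⟨m, hmk⟩
  obtain ⟨a, b, hab, ha, hb, har, hbr⟩ := last_ear (r := r) _ hpp hml hinner' havoid'
  exact hS.final hab ha hb har hbr

/-- `x` and `y` are linked inside the vertex set `S`. -/
def Lk {V : Type u} (G : SimpleGraph V) (S : Set V) (x y : V) : Prop :=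
  ∃ w : G.Walk x y, ∀ z ∈ w.support, z ∈ S

theorem Lk.refl {V : Type u} {G : SimpleGraph V} {S : Set V} {x : V} (h : x ∈ S) : Lk G S x x :=
  ⟨Walk.nil, by simpa using h⟩

theorem Lk.symm {V : Type u} {G : SimpleGraph V} {S : Set V} {x y : V} (h : Lk G S x y) :
    Lk G S y x := by
  obtain ⟨w, hw⟩ := h
  exact ⟨w.reverse, by simpa using hw⟩

theorem Lk.trans {V : Type u} {G : SimpleGraph V} {S : Set V} {x y z : V} (h : Lk G S x y)
    (h' : Lk G S y z) : Lk G S x z := by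
  obtain ⟨w, hw⟩ := h
  obtain ⟨w', hw'⟩ := h'
  refine ⟨w.append w', ?_⟩
  intro a ha
  rcases (Walk.mem_support_append_iff _ _).1 ha with h | h
  · exact hw a h
  · exact hw' a h

theorem Lk.mono {V : Type u} {G : SimpleGraph V} {S T : Set V} {x y : V} (h : Lk G S x y)
    (hST : S ⊆ T) : Lk G T x y := by
  obtain ⟨w, hw⟩ := h
  exact ⟨w, fun z hz => hST (hw z hz)⟩

theorem Lk.of_adj {V : Type u} {G : SimpleGraph V} {S : Set V} {x y : V} (hx : x ∈ S) (hy : y ∈ S)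
    (h : G.Adj x y) : Lk G S x y :=
  ⟨Walk.cons h Walk.nil, by simp [hx, hy]⟩

theorem Lk.right_mem {V : Type u} {G : SimpleGraph V} {S : Set V} {x y : V} (h : Lk G S x y) :
    y ∈ S := by
  obtain ⟨w, hw⟩ := h
  exact hw _ w.end_mem_support

theorem Lk.left_mem {V : Type u} {G : SimpleGraph V} {S : Set V} {x y : V} (h : Lk G S x y) :
    x ∈ S := h.symm.right_mem

theorem Lk.of_connected {V : Type u} {G : SimpleGraph V} {S : Set V} {x y : V}
    (h : (G.induce S).Connected) (hx : x ∈ S) (hy : y ∈ S) : Lk G S x y := by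
  obtain ⟨w⟩ := h.preconnected ⟨x, hx⟩ ⟨y, hy⟩
  refine ⟨w.map (Embedding.induce S).toHom, ?_⟩
  intro z hz
  have hz' : z ∈ (w.map (Embedding.induce (G := G) S).toHom).support := hz
  rw [Walk.support_map, List.mem_map] at hz'
  obtain ⟨a, -, rfl⟩ := hz'
  exact a.2

/-- the boundary of a separated vertex set has at least three vertices -/
theorem three_nbrs {V : Type u} {G : SimpleGraph V} (hK : KConnected 3 G) {S N : Set V} {x y : V}
    (hx : x ∈ S) (hxN : x ∉ N) (hyS : y ∉ S) (hyN : y ∉ N)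
    (h : ∀ a ∈ S, ∀ b, G.Adj a b → b ∈ S ∨ b ∈ N) : 2 < N.ncard := by
  by_contra hcon
  have hc := hK.2 N (by omega)
  obtain ⟨w⟩ := hc.preconnected ⟨x, hxN⟩ ⟨y, hyN⟩
  obtain ⟨d, hd, h1, h2⟩ := w.exists_boundary_dart {z | z.1 ∈ S} hx hyS
  have hadj : G.Adj d.fst.1 d.snd.1 := d.adj
  rcases h _ h1 _ hadj with h | h
  · exact h2 h
  · exact d.snd.2 h

theorem nbr_card {V : Type u} [Fintype V] {G : SimpleGraph V} (hK : KConnected 3 G) (v : V) :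
    2 < {w | G.Adj v w}.ncard := by
  by_cases h : ∃ y, y ≠ v ∧ ¬ G.Adj v y
  · obtain ⟨y, hy, hy'⟩ := h
    refine three_nbrs hK (S := {v}) (x := v) (y := y) rfl (by simp) hy hy' ?_
    rintro a rfl b hb
    exact Or.inr hb
  · push Not at h
    have h1 : (Set.univ : Set V) ⊆ insert v {w | G.Adj v w} := by
      intro y _
      by_cases hy : y = v
      · exact Or.inl hy
      · exact Or.inr (h y hy)
    have h2 := Set.ncard_le_ncard h1 (Set.toFinite _)
    have h3 := Set.ncard_insert_le v {w | G.Adj v w}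
    have h4 := hK.1
    rw [Set.ncard_univ] at h2
    omega

/-- two distinct vertices of `A` are linked through vertices outside `A ∪ K` -/
def HasR {V : Type u} (G : SimpleGraph V) (A K : Set V) : Prop :=
  ∃ s t a b, s ∈ A ∧ t ∈ A ∧ s ≠ t ∧ G.Adj s a ∧ G.Adj t b ∧ Lk G {z | z ∉ A ∧ z ∉ K} a b

/-- the extremal choice of `K` -/
structure MaxK {V : Type u} (G : SimpleGraph V) (A K : Set V) (u : V) : Prop where
  hu : u ∈ K
  hKA : ∀ z ∈ K, z ∉ A
  conn : ∀ z ∈ K, Lk G K u z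
  hasR : HasR G A K
  hmax : ∀ q, q ∉ A → q ∉ K → ∀ k ∈ K, G.Adj q k → ¬ HasR G A (insert q K)

theorem exists_maxK {V : Type u} [Fintype V] {G : SimpleGraph V} (hK : KConnected 3 G) {A : Set V}
    {u q s t : V} (hu : u ∉ A) (hq : q ∉ A) (hqu : q ≠ u) (hs : s ∈ A) (ht : t ∈ A) (hst : s ≠ t) :
    ∃ K, MaxK G A K u := by
  have h0 : HasR G A {u} := by
    let R : Set V := {z | Lk G {z | z ∉ A ∧ z ∉ ({u} : Set V)} q z}
    let N : Set V := {z | z ∉ R ∧ ∃ a ∈ R, G.Adj a z}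
    have hqR : q ∈ R := Lk.refl ⟨hq, hqu⟩
    have hN : ∀ z ∈ N, z ∈ A ∨ z = u := by
      rintro z ⟨hz, a, ha, haz⟩
      by_contra hcon
      push Not at hcon
      exact hz (Lk.trans ha (Lk.of_adj (Lk.right_mem ha) hcon haz))
    have hfin : ∀ s' t', s' ∈ A → t' ∈ A → s' ≠ t' → s' ∈ N → t' ∈ N → HasR G A {u} := by
      rintro s' t' h1 h2 h3 ⟨-, a, ha, has⟩ ⟨-, b, hb, hbt⟩
      exact ⟨s', t', a, b, h1, h2, h3, has.symm, hbt.symm, (Lk.symm ha).trans hb⟩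
    by_cases h : ∃ y, y ∉ R ∧ y ∉ N
    · obtain ⟨y, hy, hy'⟩ := h
      have h3 := three_nbrs hK (S := R) (N := N) hqR (fun h => h.1 hqR) hy hy' (by
        intro a ha b hab
        by_cases hb : b ∈ R
        · exact Or.inl hb
        · exact Or.inr ⟨hb, a, ha, hab⟩)
      rw [Set.two_lt_ncard_iff] at h3
      obtain ⟨a, b, c, ha, hb, hc, hab, hac, hbc⟩ := h3
      rcases hN a ha with ha' | rfl
      · rcases hN b hb with hb' | rfl
        · exact hfin a b ha' hb' hab ha hb
        · exact hfin a c ha' ((hN c hc).resolve_right hbc.symm) hac ha hc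
      · exact hfin b c ((hN b hb).resolve_right hab.symm) ((hN c hc).resolve_right hac.symm) hbc
          hb hc
    · push Not at h
      have hnR : ∀ z ∈ A, z ∉ R := fun z hz hz' => (Lk.right_mem hz').1 hz
      exact hfin s t hs ht hst (h s (hnR s hs)) (h t (hnR t ht))
  let C : Set (Set V) := {K | u ∈ K ∧ (∀ z ∈ K, z ∉ A) ∧ (∀ z ∈ K, Lk G K u z) ∧ HasR G A K}
  have hCne : C.Nonempty := by
    refine ⟨{u}, rfl, ?_, ?_, h0⟩
    · rintro z rfl; exact hu
    · rintro z rfl; exact Lk.refl rfl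
  obtain ⟨K, hKm⟩ := (Set.toFinite C).exists_maximal hCne
  obtain ⟨h1, h2, h3, h4⟩ := hKm.prop
  refine ⟨K, h1, h2, h3, h4, ?_⟩
  intro q hqA hqK k hk hqk hR
  have hmem : insert q K ∈ C := by
    refine ⟨Or.inr h1, ?_, ?_, hR⟩
    · rintro z (rfl | hz)
      · exact hqA
      · exact h2 z hz
    · rintro z (rfl | hz)
      · exact ((h3 k hk).mono (Set.subset_insert _ _)).trans
          (Lk.of_adj (Or.inr hk) (Or.inl rfl) hqk.symm)
      · exact (h3 z hz).mono (Set.subset_insert _ _)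
  exact hqK (hKm.le_of_ge hmem (Set.subset_insert _ _) (Set.mem_insert _ _))

theorem lk_initial {V : Type u} {G : SimpleGraph V} {a b : V} (p : G.Walk a b) (hp : p.IsPath)
    {T : Set V} (hT : ∀ z ∈ p.support, z ∈ T) {i j : ℕ} (hij : i < j) (hj : j ≤ p.length) :
    Lk G {z | z ∈ T ∧ z ≠ p.getVert j} a (p.getVert i) := by
  refine ⟨p.take i, ?_⟩
  intro z hz
  obtain ⟨n, rfl, hn⟩ := Walk.mem_support_iff_exists_getVert.1 hz
  rw [Walk.take_getVert]
  refine ⟨hT _ (p.getVert_mem_support _), ?_⟩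
  intro h
  have := hp.getVert_injOn (show i ⊓ n ∈ {i | i ≤ p.length} by
    have : i ⊓ n ≤ i := inf_le_left
    simp only [Set.mem_ofPred_eq]; omega) (show j ∈ {i | i ≤ p.length} from hj) h
  have := Nat.min_le_left i n
  simp_all
  omega

theorem lk_final {V : Type u} {G : SimpleGraph V} {a b : V} (p : G.Walk a b) (hp : p.IsPath)
    {T : Set V} (hT : ∀ z ∈ p.support, z ∈ T) {i j : ℕ} (hij : j < i) (hi : i ≤ p.length) :
    Lk G {z | z ∈ T ∧ z ≠ p.getVert j} (p.getVert i) b := by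
  refine ⟨p.drop i, ?_⟩
  intro z hz
  obtain ⟨n, rfl, hn⟩ := Walk.mem_support_iff_exists_getVert.1 hz
  rw [Walk.drop_getVert]
  refine ⟨hT _ (p.getVert_mem_support _), ?_⟩
  intro h
  rw [Walk.drop_length] at hn
  have := hp.getVert_injOn (show i + n ∈ {i | i ≤ p.length} by
    simp only [Set.mem_ofPred_eq]; omega) (show j ∈ {i | i ≤ p.length} by
    simp only [Set.mem_ofPred_eq]; omega) h
  omega

theorem maxK_all {V : Type u} [Fintype V] {G : SimpleGraph V} (hK : KConnected 3 G) {A K : Set V}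
    {u s t a b : V} (hM : MaxK G A K u) (hH : ∀ z, z ∉ A → Lk G Aᶜ u z)
    (hs : s ∈ A) (ht : t ∈ A) (hst : s ≠ t) (hsa : G.Adj s a) (htb : G.Adj t b)
    (p : G.Walk a b) (hp : p.IsPath) (hpW : ∀ z ∈ p.support, z ∈ {z | z ∉ A ∧ z ∉ K}) :
    ∀ q, q ∉ A → q ∉ K → q ∈ p.support ∧ ∃ k ∈ K, G.Adj q k := by
  have hatt : ∀ q, q ∉ A → q ∉ K → (∃ k ∈ K, G.Adj q k) → q ∈ p.support := by
    rintro q hqA hqK ⟨k, hk, hqk⟩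
    by_contra hq
    refine hM.hmax q hqA hqK k hk hqk ⟨s, t, a, b, hs, ht, hst, hsa, htb, p, ?_⟩
    intro z hz
    refine ⟨(hpW z hz).1, ?_⟩
    rintro (rfl | h)
    · exact hq hz
    · exact (hpW z hz).2 h
  suffices hall : ∀ q, q ∉ A → q ∉ K → ∃ k ∈ K, G.Adj q k from
    fun q h1 h2 => ⟨hatt q h1 h2 (hall q h1 h2), hall q h1 h2⟩
  intro q hqA hqK
  by_contra hqn
  -- the non-attached part
  let Q : Set V := {z | z ∉ A ∧ z ∉ K ∧ ¬ ∃ k ∈ K, G.Adj z k}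
  let S : Set V := {z | Lk G Q q z}
  let N : Set V := {z | z ∉ S ∧ ∃ a ∈ S, G.Adj a z}
  have hqS : q ∈ S := Lk.refl ⟨hqA, hqK, hqn⟩
  have hSQ : ∀ z ∈ S, z ∈ Q := fun z hz => Lk.right_mem hz
  have hN : ∀ z ∈ N, z ∈ A ∨ (z ∉ A ∧ z ∉ K ∧ ∃ k ∈ K, G.Adj z k) := by
    rintro z ⟨hz, a, ha, haz⟩
    by_contra hcon
    push Not at hcon
    have haQ := hSQ a ha
    have hzK : z ∉ K := fun h => haQ.2.2 ⟨z, h, haz⟩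
    refine hz (Lk.trans ha (Lk.of_adj haQ ⟨hcon.1, hzK, ?_⟩ haz))
    rintro ⟨k, hk, hzk⟩
    exact hcon.2 hcon.1 hzK k hk hzk
  have huS : u ∉ S := fun h => (hSQ u h).2.1 hM.hu
  have huN : u ∉ N := by
    intro h
    rcases hN u h with h | h
    · exact hM.hKA u hM.hu h
    · exact h.2.1 hM.hu
  have h3 := three_nbrs hK (S := S) (N := N) hqS (fun h => h.1 hqS) huS huN (by
    intro a ha b hab
    by_cases hb : b ∈ S
    · exact Or.inl hb
    · exact Or.inr ⟨hb, a, ha, hab⟩)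
  rw [Set.two_lt_ncard_iff] at h3
  -- removing an attached vertex `y` gives a contradiction as soon as a link avoids `y`
  have kill : ∀ y, y ∉ A → y ∉ K → (∃ k ∈ K, G.Adj y k) → ∀ s t a b, s ∈ A → t ∈ A → s ≠ t →
      G.Adj s a → G.Adj t b → Lk G {z | z ∈ {z | z ∉ A ∧ z ∉ K} ∧ z ≠ y} a b → False := by
    rintro y hyA hyK ⟨k, hk, hyk⟩ s t a b hs ht hst hsa htb hab
    refine hM.hmax y hyA hyK k hk hyk ⟨s, t, a, b, hs, ht, hst, hsa, htb, hab.mono ?_⟩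
    rintro z ⟨⟨h1, h2⟩, h3⟩
    refine ⟨h1, ?_⟩
    rintro (h | h)
    · exact h3 h
    · exact h2 h
  -- links through S
  have hSS : ∀ y, (∃ k ∈ K, G.Adj y k) → ∀ x z, x ∈ S → z ∈ S →
      Lk G {z | z ∈ {z | z ∉ A ∧ z ∉ K} ∧ z ≠ y} x z := by
    intro y hy x z hx hz
    refine Lk.mono (Lk.trans (Lk.symm hx) hz) ?_
    rintro w ⟨h1, h2, h3⟩
    refine ⟨⟨h1, h2⟩, ?_⟩
    rintro rfl
    exact h3 hy
  -- a link from an attached neighbour into S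
  have hNS : ∀ y, (∃ k ∈ K, G.Adj y k) → ∀ x ∈ N, x ∉ A → x ≠ y → ∀ z ∈ S,
      Lk G {z | z ∈ {z | z ∉ A ∧ z ∉ K} ∧ z ≠ y} x z := by
    rintro y hy x hx hxA hxy z hz
    have hx' := (hN x hx).resolve_left hxA
    obtain ⟨-, c, hc, hcx⟩ := hx
    exact (Lk.of_adj (S := {z | z ∈ {z | z ∉ A ∧ z ∉ K} ∧ z ≠ y}) ⟨⟨hxA, hx'.2.1⟩, hxy⟩ (hSS y hy c c hc hc).left_mem hcx.symm).trans
      (hSS y hy c z hc hz)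
  -- two neighbours in A
  have case2 : ∀ x y, x ∈ N → y ∈ N → x ∈ A → y ∈ A → x ≠ y → False := by
    rintro x y ⟨-, c, hc, hcx⟩ ⟨-, d, hd, hdy⟩ hxA hyA hxy
    -- an attached vertex exists
    obtain ⟨w, hw⟩ := hH q hqA
    obtain ⟨e, he, he1, he2⟩ := w.exists_boundary_dart K hM.hu hqK
    have heA : e.snd ∉ A := hw _ (w.dart_snd_mem_support_of_mem_darts he)
    have hek : ∃ k ∈ K, G.Adj e.snd k := ⟨e.fst, he1, e.adj.symm⟩
    exact kill e.snd heA he2 hek x y c d hxA hyA hxy hcx.symm hdy.symm (hSS _ hek c d hc hd)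
  -- one neighbour in A
  have case1' : ∀ z i j, z ∈ N → z ∈ A → i < j → j ≤ p.length → p.getVert i ∈ N →
      p.getVert j ∈ N → False := by
    rintro z i j hz hzA hij hj hi' hj'
    have hpi := hpW _ (p.getVert_mem_support i)
    have hpj := hpW _ (p.getVert_mem_support j)
    have hai := (hN _ hi').resolve_left hpi.1
    have haj := (hN _ hj').resolve_left hpj.1
    have hne : p.getVert i ≠ p.getVert j := by
      intro h
      have := hp.getVert_injOn (show i ∈ {i | i ≤ p.length} by
        simp only [Set.mem_ofPred_eq]; omega) (show j ∈ {i | i ≤ p.length} from hj) h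
      omega
    obtain ⟨-, c, hc, hcz⟩ := hz
    by_cases hzs : z = s
    · have hzt : t ≠ z := by rw [hzs]; exact hst.symm
      refine kill _ hai.1 hai.2.1 hai.2.2 t z b c ht hzA hzt htb hcz.symm ?_
      exact (lk_final p hp hpW hij hj).symm.trans (hNS _ hai.2.2 _ hj' hpj.1 hne.symm c hc)
    · refine kill _ haj.1 haj.2.1 haj.2.2 s z a c hs hzA (Ne.symm hzs) hsa hcz.symm ?_
      exact (lk_initial p hp hpW hij hj).trans (hNS _ haj.2.2 _ hi' hpi.1 hne c hc)
  have idx : ∀ x, x ∈ N → x ∉ A → ∃ i, p.getVert i = x ∧ i ≤ p.length := by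
    intro x hx hxA
    have hx' := (hN x hx).resolve_left hxA
    obtain ⟨i, hi, hi'⟩ := Walk.mem_support_iff_exists_getVert.1 (hatt x hx'.1 hx'.2.1 hx'.2.2)
    exact ⟨i, hi, hi'⟩
  have case1 : ∀ x y z, z ∈ N → z ∈ A → x ∈ N → y ∈ N → x ∉ A → y ∉ A → x ≠ y → False := by
    intro x y z hz hzA hx hy hxA hyA hxy
    obtain ⟨i, rfl, hi⟩ := idx x hx hxA
    obtain ⟨j, rfl, hj⟩ := idx y hy hyA
    rcases lt_trichotomy i j with h | h | h
    · exact case1' z i j hz hzA h hj hx hy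
    · exact hxy (by rw [h])
    · exact case1' z j i hz hzA h hi hy hx
  have case0' : ∀ i j k, i < j → j < k → k ≤ p.length → p.getVert i ∈ N →
      p.getVert j ∈ N → p.getVert k ∈ N → False := by
    intro i j k hij hjk hk hi' hj' hk'
    have hpi := hpW _ (p.getVert_mem_support i)
    have hpj := hpW _ (p.getVert_mem_support j)
    have hpk := hpW _ (p.getVert_mem_support k)
    have haj := (hN _ hj').resolve_left hpj.1
    have L1 := lk_initial p hp hpW hij (by omega)
    have L2 := lk_final p hp hpW hjk hk
    refine kill _ haj.1 haj.2.1 haj.2.2 s t a b hs ht hst hsa htb ?_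
    exact (L1.trans (hNS _ haj.2.2 _ hi' hpi.1 L1.right_mem.2 q hqS)).trans
      ((hNS _ haj.2.2 _ hk' hpk.1 L2.left_mem.2 q hqS).symm.trans L2)
  have case0 : ∀ x y z, x ∈ N → y ∈ N → z ∈ N → x ∉ A → y ∉ A → z ∉ A →
      x ≠ y → x ≠ z → y ≠ z → False := by
    intro x y z hx hy hz hxA hyA hzA hxy hxz hyz
    obtain ⟨i, rfl, hi⟩ := idx x hx hxA
    obtain ⟨j, rfl, hj⟩ := idx y hy hyA
    obtain ⟨k, rfl, hk⟩ := idx z hz hzA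
    have hij : i ≠ j := fun h => hxy (by rw [h])
    have hik : i ≠ k := fun h => hxz (by rw [h])
    have hjk : j ≠ k := fun h => hyz (by rw [h])
    rcases lt_or_gt_of_ne hij with h1 | h1 <;> rcases lt_or_gt_of_ne hik with h2 | h2 <;>
      rcases lt_or_gt_of_ne hjk with h3 | h3
    · exact case0' i j k h1 h3 hk hx hy hz
    · exact case0' i k j h2 h3 hj hx hz hy
    · omega
    · exact case0' k i j h2 h1 hj hz hx hy
    · exact case0' j i k h1 h2 hk hy hx hz
    · omega
    · exact case0' j k i h3 h2 hi hy hz hx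
    · exact case0' k j i h3 h1 hi hz hy hx
  obtain ⟨x, y, z, hx, hy, hz, hxy, hxz, hyz⟩ := h3
  by_cases hxA : x ∈ A <;> by_cases hyA : y ∈ A <;> by_cases hzA : z ∈ A
  · exact case2 x y hx hy hxA hyA hxy
  · exact case2 x y hx hy hxA hyA hxy
  · exact case2 x z hx hz hxA hzA hxz
  · exact case1 y z x hx hxA hy hz hyA hzA hyz
  · exact case2 y z hy hz hyA hzA hyz
  · exact case1 x z y hy hyA hx hz hxA hzA hxz
  · exact case1 x y z hz hzA hx hy hxA hyA hxy
  · exact case0 x y z hx hy hz hxA hyA hzA hxy hxz hyz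

/-- the ear obtained from the extremal set -/
theorem exists_ear {V : Type u} [Fintype V] {G : SimpleGraph V} (hK : KConnected 3 G) {A K : Set V}
    {u : V} (hM : MaxK G A K u) (hH : ∀ z, z ∉ A → Lk G Aᶜ u z) {s t a b : V}
    (hs : s ∈ A) (ht : t ∈ A) (hst : s ≠ t) (hsa : G.Adj s a) (htb : G.Adj t b)
    (hab : Lk G {z | z ∉ A ∧ z ∉ K} a b) :
    ∃ P : G.Walk s t, P.IsPath ∧ 2 ≤ P.length ∧
      (∀ x, x ∈ P.support ↔ x = s ∨ x = t ∨ (x ∉ A ∧ x ∉ K)) ∧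
      (∀ x, x ∉ A → x ∉ K → ∃ k ∈ K, G.Adj x k) ∧
      (∀ x y, x ∉ A → x ∉ K → y ∉ A → y ∉ K → x ≠ y → G.Adj t x → G.Adj t y → False) := by
  classical
  obtain ⟨w, hw⟩ := hab
  let p := w.bypass
  have hp : p.IsPath := w.bypass_isPath
  have hpW : ∀ z ∈ p.support, z ∈ {z | z ∉ A ∧ z ∉ K} := fun z hz =>
    hw z (w.support_bypass_subset_support hz)
  have hall := maxK_all hK hM hH hs ht hst hsa htb p hp hpW
  have hsp : s ∉ p.support := fun h => (hpW s h).1 hs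
  have htp : t ∉ p.support := fun h => (hpW t h).1 ht
  refine ⟨Walk.cons hsa (p.concat htb.symm), ?_, ?_, ?_, ?_, ?_⟩
  · rw [Walk.cons_isPath_iff]
    refine ⟨hp.concat htp _, ?_⟩
    simp [Walk.support_concat, hsp, hst]
  · simp
  · intro x
    simp only [Walk.support_cons, List.mem_cons, Walk.support_concat,
      List.mem_append, List.not_mem_nil, or_false]
    have h1 := hpW x
    have h2 := hall x
    simp only [Set.mem_ofPred_eq] at h1
    tauto
  · exact fun x h1 h2 => (hall x h1 h2).2
  · have main : ∀ i j, i < j → j ≤ p.length → G.Adj t (p.getVert i) → False := by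
      intro i j hij hj hti
      have hpj := hpW _ (p.getVert_mem_support j)
      obtain ⟨k, hk, hjk⟩ := (hall _ hpj.1 hpj.2).2
      refine hM.hmax _ hpj.1 hpj.2 k hk hjk ⟨s, t, a, p.getVert i, hs, ht, hst, hsa, hti,
        (lk_initial p hp hpW hij hj).mono ?_⟩
      rintro z ⟨⟨h1, h2⟩, h3⟩
      refine ⟨h1, ?_⟩
      rintro (h | h)
      · exact h3 h
      · exact h2 h
    intro x y hx hx' hy hy' hxy htx hty
    obtain ⟨i, rfl, hi⟩ := Walk.mem_support_iff_exists_getVert.1 (hall x hx hx').1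
    obtain ⟨j, rfl, hj⟩ := Walk.mem_support_iff_exists_getVert.1 (hall y hy hy').1
    rcases lt_trichotomy i j with h | h | h
    · exact main i j h hj htx
    · exact hxy (by rw [h])
    · exact main j i h hi hty

theorem stage_descend {V : Type u} [Fintype V] {G : SimpleGraph V} (hK : KConnected 3 G)
    {r u x0 : V} (hxr : x0 ≠ r) (n : ℕ) : ∀ K : Set V, K.ncard ≤ n → Stage G r Kᶜ → u ∈ K →
      r ∉ K → x0 ∉ K → (∀ z ∈ K, Lk G K u z) → Stage G r {u}ᶜ := by
  induction n with
  | zero =>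
    intro K hn _ hu
    have := (Set.ncard_pos (Set.toFinite K)).2 ⟨u, hu⟩
    omega
  | succ n ih =>
    intro K hn hS hu hr hx0 hconn
    by_cases hq : ∃ q ∈ K, q ≠ u
    swap
    · push Not at hq
      have : K = {u} := by
        ext z; constructor
        · exact hq z
        · rintro rfl; exact hu
      rwa [this] at hS
    obtain ⟨q, hqK, hqu⟩ := hq
    obtain ⟨L, hL⟩ := exists_maxK hK (A := Kᶜ) (u := u) (q := q) (s := r) (t := x0)
      (by simpa using hu) (by simpa using hqK) hqu hr hx0 hxr.symm
    obtain ⟨s, t, a, b, hs, ht, hst, hsa, htb, hab⟩ := hL.hasR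
    obtain ⟨P, hP, hPl, hPs, hPa, -⟩ := exists_ear hK hL (by
      intro z hz
      rw [compl_compl]
      exact hconn z (by simpa using hz)) hs ht hst hsa htb hab
    have hLK : L ⊆ K := fun z hz => by simpa using hL.hKA z hz
    have hnew := stage_path _ P le_rfl hS hP hs ht (by
      intro x hx hxA
      rcases (hPs x).1 hx with h | h | h
      · exact Or.inl h
      · exact Or.inr h
      · exact absurd hxA h.1) (by
      intro x hx hxA
      rcases (hPs x).1 hx with rfl | rfl | h
      · exact absurd hs hxA
      · exact absurd ht hxA
      · obtain ⟨k, hk, hxk⟩ := hPa x h.1 h.2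
        refine ⟨k, hL.hKA k hk, ?_, hxk⟩
        rw [hPs]
        rintro (rfl | rfl | h)
        · exact hL.hKA _ hk hs
        · exact hL.hKA _ hk ht
        · exact h.2 hk)
    have hset : Kᶜ ∪ {x | x ∈ P.support} = Lᶜ := by
      ext x
      simp only [Set.mem_union, Set.mem_ofPred_eq, hPs, Set.mem_compl_iff, not_not]
      constructor
      · rintro (h | rfl | rfl | h)
        · exact fun h' => h (hLK h')
        · exact fun h' => hs (hLK h')
        · exact fun h' => ht (hLK h')
        · exact h.2
      · intro h
        by_cases hx : x ∈ K
        · exact Or.inr (Or.inr (Or.inr ⟨hx, h⟩))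
        · exact Or.inl hx
    rw [hset] at hnew
    have haL := hab.left_mem
    have hlt : L ⊂ K := by
      refine ⟨hLK, fun h => haL.2 (h ?_)⟩
      simpa using haL.1
    have := Set.ncard_lt_ncard hlt (Set.toFinite K)
    exact ih L (by omega) hnew hL.hu (fun h => hr (hLK h)) (fun h => hx0 (hLK h)) hL.conn

theorem exists_stage {V : Type u} [Fintype V] {G : SimpleGraph V} (hK : KConnected 3 G)
    {r u : V} (hru : G.Adj r u) : Stage G r {u}ᶜ := by
  have hdeg := nbr_card hK r
  obtain ⟨x, hrx, hxu⟩ : ∃ x, G.Adj r x ∧ x ≠ u := by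
    rw [Set.two_lt_ncard_iff] at hdeg
    obtain ⟨a, b, c, ha, hb, hc, hab, -, -⟩ := hdeg
    by_cases h : a = u
    · exact ⟨b, hb, fun h' => hab (h.trans h'.symm)⟩
    · exact ⟨a, ha, h⟩
  let A : Set V := {r, x}
  have hmemA : ∀ z, z ∈ A ↔ z = r ∨ z = x := fun z => Iff.rfl
  have huA : u ∉ A := by
    rw [hmemA]
    rintro (h | h)
    · exact hru.ne h.symm
    · exact hxu h.symm
  have hH : ∀ z, z ∉ A → Lk G Aᶜ u z := by
    intro z hz
    refine Lk.of_connected (hK.2 A ?_) huA hz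
    have := Set.ncard_pair hrx.ne
    change ({r, x} : Set V).ncard < 3
    omega
  obtain ⟨q, hqA, hqu⟩ : ∃ q, q ∉ A ∧ q ≠ u := by
    by_contra hcon
    push Not at hcon
    have h1 : (Set.univ : Set V) ⊆ insert u A := by
      intro z _
      by_cases hz : z ∈ A
      · exact Or.inr hz
      · exact Or.inl (hcon z hz)
    have h2 := Set.ncard_le_ncard h1 (Set.toFinite _)
    have h3 := Set.ncard_insert_le u A
    have h4 := hK.1
    have h5 : A.ncard = 2 := Set.ncard_pair hrx.ne
    rw [Set.ncard_univ] at h2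
    omega
  have hrA : r ∈ A := Or.inl rfl
  have hxA : x ∈ A := Or.inr rfl
  obtain ⟨K, hM⟩ := exists_maxK hK huA hqA hqu hrA hxA hrx.ne
  obtain ⟨a, b, hra, hxb, hab⟩ : ∃ a b, G.Adj r a ∧ G.Adj x b ∧
      Lk G {z | z ∉ A ∧ z ∉ K} a b := by
    obtain ⟨s, t, a, b, hs, ht, hst, hsa, htb, hab⟩ := hM.hasR
    rcases hs with rfl | rfl <;> rcases ht with rfl | rfl
    · exact absurd rfl hst
    · exact ⟨a, b, hsa, htb, hab⟩
    · exact ⟨b, a, htb, hsa, hab.symm⟩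
    · exact absurd rfl hst
  obtain ⟨P, hP, hPl, hPs, hPa, hPx⟩ := exists_ear hK hM hH hrA hxA hrx.ne hra hxb hab
  have hC : (Walk.cons hrx.symm P).IsCycle := by
    rw [Walk.cons_isCycle_iff]
    refine ⟨hP, ?_⟩
    intro h
    rw [Sym2.eq_swap] at h
    have := hP.length_eq_one_of_mem_edges h
    omega
  have hrK : r ∉ K := fun h => hM.hKA r h hrA
  have hxK : x ∉ K := fun h => hM.hKA x h hxA
  have hCs : ∀ z, z ∈ (Walk.cons hrx.symm P).support ↔ z ∉ K := by
    intro z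
    simp only [Walk.support_cons, List.mem_cons, hPs, hmemA]
    constructor
    · rintro (rfl | rfl | rfl | h)
      · exact hxK
      · exact hrK
      · exact hxK
      · exact h.2
    · intro h
      tauto
  have hxK' : ∃ k ∈ K, G.Adj x k := by
    by_contra hcon
    push Not at hcon
    have h3 := nbr_card hK x
    rw [Set.two_lt_ncard_iff] at h3
    obtain ⟨y1, y2, y3, h1, h2, h3, h12, h13, h23⟩ := h3
    have hy : ∀ y, G.Adj x y → y ≠ r → y ∉ A ∧ y ∉ K := by
      intro y hxy hyr
      refine ⟨?_, fun h => hcon y h hxy⟩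
      rintro (h | h)
      · exact hyr h
      · exact hxy.ne h.symm
    have hfin : ∀ y z, G.Adj x y → G.Adj x z → y ≠ z → y ≠ r → z ≠ r → False := by
      intro y z hxy hxz hyz hyr hzr
      exact hPx y z (hy y hxy hyr).1 (hy y hxy hyr).2 (hy z hxz hzr).1 (hy z hxz hzr).2 hyz hxy hxz
    by_cases e1 : y1 = r
    · subst e1
      exact hfin y2 y3 h2 h3 h23 h12.symm h13.symm
    · by_cases e2 : y2 = r
      · subst e2
        exact hfin y1 y3 h1 h3 h13 e1 h23.symm
      · exact hfin y1 y2 h1 h2 h12 e1 e2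
  have hS := stage_cycle (r := r) _ (Walk.cons hrx.symm P) le_rfl hC ((hCs r).2 hrK) (by
    intro z hz
    have : ∃ k ∈ K, G.Adj z k := by
      by_cases hzA : z ∈ A
      · rcases hzA with rfl | rfl
        · exact ⟨u, hM.hu, hru⟩
        · exact hxK'
      · exact hPa z hzA ((hCs z).1 hz)
    obtain ⟨k, hk, hzk⟩ := this
    exact ⟨k, by rw [hCs]; simpa using hk, hzk⟩)
  have hset : {z | z ∈ (Walk.cons hrx.symm P).support} = Kᶜ := by
    ext z; exact hCs z
  rw [hset] at hS
  exact stage_descend hK hrx.ne' _ K le_rfl hS hM.hu hrK hxK hM.conn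

theorem threeConn_induced {V : Type u} [Fintype V] {G : SimpleGraph V} (hK : KConnected 3 G)
    {r u : V} (hru : G.Adj r u) :
    ∃ D' : EarDecomposition G, IsMondshein D' r u ∧ D'.IsInducedDecomp := by
  have hS := exists_stage hK hru
  have hdeg := nbr_card hK u
  rw [Set.two_lt_ncard_iff] at hdeg
  obtain ⟨a, b, c, ha, hb, hc, hab, hac, hbc⟩ := hdeg
  by_cases h1 : a = r
  · subst h1
    exact hS.final hbc hb hc hab.symm hac.symm
  · by_cases h2 : b = r
    · subst h2
      exact hS.final hac ha hc h1 hbc.symm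
    · exact hS.final hab ha hb h1 h2

/-- For every Mondshein sequence of a finite simple graph `G` avoiding
an edge `ru` there exists an induced Mondshein sequence of `G` avoiding `ru`; in
particular, every 3-connected graph `G` with an edge `ru` has an induced Mondshein
sequence avoiding `ru`. -/
theorem induced_mondshein {V : Type u} [Fintype V] (G : SimpleGraph V)
    (r u : V) (hru : G.Adj r u) :
    (∀ D : EarDecomposition G, IsMondshein D r u →
      ∃ D' : EarDecomposition G, IsMondshein D' r u ∧ D'.IsInducedDecomp) ∧
    (KConnected 3 G →
      ∃ D' : EarDecomposition G, IsMondshein D' r u ∧ D'.IsInducedDecomp) := by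
  exact ⟨fun D hD => mondshein_induced D hD, fun hK => threeConn_induced hK hru⟩
end

section
/- Let G be a finite simple 3-connected graph, let D = (P_0,...,P_{m-n}) be a Mondshein sequence of G avoiding an edge ru, and let t be a neighbor of r on the cycle P_0 with t ≠ u. Then there exists an ordering of the vertices of G that is a tr-numbering of the subgraph G_i for every 0 <= i <= m−n (a consistent tr-numbering). -/
open SimpleGraph

universe u

variable {V : Type u}

/-- `π` is an `ab`-numbering of the subgraph `H`: among the vertices of `H`, `a` gets
the smallest and `b` the largest number, and every other vertex of `H` has both a
lower-numbered and a higher-numbered neighbor in `H`. -/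
def IsStNumbering {G : SimpleGraph V} (H : G.Subgraph) (a b : V) (π : V → ℕ) : Prop :=
  a ∈ H.verts ∧ b ∈ H.verts ∧
  (∀ v ∈ H.verts, π a ≤ π v ∧ π v ≤ π b) ∧
  ∀ v ∈ H.verts, v ≠ a → v ≠ b →
    (∃ w ∈ H.neighborSet v, π w < π v) ∧ (∃ w ∈ H.neighborSet v, π v < π w)

theorem path_length_zero {V : Type u} {G : SimpleGraph V} {a b : V} (p : G.Walk a b)
    (hp : p.IsPath) (hab : a = b) : p.length = 0 := by
  subst hab
  rw [Walk.isPath_iff_nil] at hp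
  exact Walk.nil_iff_length_eq.1 hp

theorem path_insert {V : Type u} [Finite V] {G : SimpleGraph V} {a b : V} (p : G.Walk a b) :
    p.IsPath → ∀ f : V → ℚ, Function.Injective f → f a < f b →
    ∃ f' : V → ℚ, Function.Injective f' ∧
      (∀ x, (x ∉ p.support ∨ x = a ∨ x = b) → f' x = f x) ∧
      (∀ x ∈ p.support, f a ≤ f' x ∧ f' x ≤ f b) ∧
      (∀ x ∈ p.support, x ≠ b → ∃ w, p.toSubgraph.Adj x w ∧ f' x < f' w) ∧
      (∀ x ∈ p.support, x ≠ a → ∃ w, p.toSubgraph.Adj x w ∧ f' w < f' x) := by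
  classical
  induction p with
  | nil => intro _ f _ h; exact absurd h (lt_irrefl _)
  | @cons a c b h q ih =>
    intro hp f hf hab
    rw [Walk.cons_isPath_iff] at hp
    obtain ⟨hq, haq⟩ := hp
    by_cases hcb : c = b
    · subst hcb
      have hqn : q = Walk.nil := by
        rw [Walk.isPath_iff_nil, Walk.nil_iff_eq_nil] at hq; exact hq
      subst hqn
      refine ⟨f, hf, fun _ _ => rfl, ?_, ?_, ?_⟩
      · intro x hx
        simp at hx
        rcases hx with rfl | rfl
        · exact ⟨le_rfl, hab.le⟩
        · exact ⟨hab.le, le_rfl⟩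
      · intro x hx hxb
        simp at hx
        rcases hx with rfl | rfl
        · exact ⟨c, by simp, hab⟩
        · exact absurd rfl hxb
      · intro x hx hxb
        simp at hx
        rcases hx with rfl | rfl
        · exact absurd rfl hxb
        · exact ⟨a, by simp [Subgraph.adj_comm], hab⟩
    · have hinf : (Set.Ioo (f a) (f b) \ Set.range f).Nonempty :=
        ((Set.Ioo_infinite hab).sdiff (Set.finite_range f)).nonempty
      obtain ⟨z, ⟨hz1, hz2⟩, hz3⟩ := hinf
      have hac : a ≠ c := h.ne
      have hbc : b ≠ c := fun e => hcb e.symm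
      have hab' : a ≠ b := fun e => by subst e; exact lt_irrefl _ hab
      have hf1 : Function.Injective (Function.update f c z) := by
        intro x y hxy
        by_cases hx : x = c <;> by_cases hy : y = c
        · rw [hx, hy]
        · subst hx; simp [Function.update_of_ne hy] at hxy
          exact absurd ⟨y, hxy.symm⟩ hz3
        · subst hy; simp [Function.update_of_ne hx] at hxy
          exact absurd ⟨x, hxy⟩ hz3
        · simp [Function.update_of_ne hx, Function.update_of_ne hy] at hxy
          exact hf hxy
      obtain ⟨f', h1, h2, h3, h4, h5⟩ := ih hq (Function.update f c z) hf1
        (by simpa [Function.update_of_ne hbc] using hz2)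
      rw [Function.update_self, Function.update_of_ne hbc] at h3
      have ea : f' a = f a := by
        rw [h2 a (Or.inl haq), Function.update_of_ne hac]
      have ec : f' c = z := by
        rw [h2 c (Or.inr (Or.inl rfl)), Function.update_self]
      have eb : f' b = f b := by
        rw [h2 b (Or.inr (Or.inr rfl)), Function.update_of_ne hbc]
      have adj1 : (Walk.cons h q).toSubgraph.Adj a c := by
        simp [Walk.toSubgraph]
      have lift : ∀ x w, q.toSubgraph.Adj x w → (Walk.cons h q).toSubgraph.Adj x w := by
        intro x w hh
        simp only [Walk.toSubgraph, Subgraph.sup_adj]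
        exact Or.inr hh
      refine ⟨f', h1, ?_, ?_, ?_, ?_⟩
      · intro x hx
        rcases hx with hx | rfl | rfl
        · simp only [Walk.support_cons, List.mem_cons, not_or] at hx
          have : x ≠ c := fun e => hx.2 (e ▸ q.start_mem_support)
          rw [h2 x (Or.inl hx.2), Function.update_of_ne this]
        · exact ea
        · exact eb
      · intro x hx
        simp only [Walk.support_cons, List.mem_cons] at hx
        rcases hx with rfl | hx
        · rw [ea]; exact ⟨le_rfl, hab.le⟩
        · exact ⟨hz1.le.trans (h3 x hx).1, (h3 x hx).2⟩
      · intro x hx hxb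
        simp only [Walk.support_cons, List.mem_cons] at hx
        rcases hx with rfl | hx
        · exact ⟨c, adj1, by rw [ea, ec]; exact hz1⟩
        · obtain ⟨w, hw, hl⟩ := h4 x hx hxb
          exact ⟨w, lift _ _ hw, hl⟩
      · intro x hx hxa
        simp only [Walk.support_cons, List.mem_cons] at hx
        rcases hx with rfl | hx
        · exact absurd rfl hxa
        · by_cases hxc : x = c
          · subst hxc
            exact ⟨a, adj1.symm, by rw [ea, ec]; exact hz1⟩
          · obtain ⟨w, hw, hl⟩ := h5 x hx hxc
            exact ⟨w, lift _ _ hw, hl⟩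

/-- Symmetric version, not requiring an orientation. -/
theorem path_insert' {V : Type u} [Finite V] {G : SimpleGraph V} {a b : V} (p : G.Walk a b)
    (hp : p.IsPath) (hab : a ≠ b) (f : V → ℚ) (hf : Function.Injective f) :
    ∃ f' : V → ℚ, Function.Injective f' ∧
      (∀ x, (x ∉ p.support ∨ x = a ∨ x = b) → f' x = f x) ∧
      (∀ x ∈ p.support, (f a ≤ f' x ∨ f b ≤ f' x) ∧ (f' x ≤ f a ∨ f' x ≤ f b)) ∧
      (∀ x ∈ p.support, x ≠ a → x ≠ b → (∃ w, p.toSubgraph.Adj x w ∧ f' w < f' x) ∧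
        ∃ w, p.toSubgraph.Adj x w ∧ f' x < f' w) := by
  rcases lt_or_gt_of_ne (fun e => hab (hf e)) with h | h
  · obtain ⟨f', h1, h2, h3, h4, h5⟩ := path_insert p hp f hf h
    exact ⟨f', h1, h2, fun x hx => ⟨Or.inl (h3 x hx).1, Or.inr (h3 x hx).2⟩,
      fun x hx ha hb => ⟨h5 x hx ha, h4 x hx hb⟩⟩
  · obtain ⟨f', h1, h2, h3, h4, h5⟩ := path_insert p.reverse hp.reverse f hf h
    simp only [Walk.support_reverse, List.mem_reverse, Walk.toSubgraph_reverse] at h2 h3 h4 h5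
    refine ⟨f', h1, fun x hx => h2 x (by tauto), fun x hx => ⟨Or.inr (h3 x hx).1, Or.inl (h3 x hx).2⟩,
      fun x hx ha hb => ⟨h5 x hx hb, h4 x hx ha⟩⟩

theorem cycle_path_snd {V : Type u} {G : SimpleGraph V} {r : V} (c : G.Walk r r)
    (hc : c.IsCycle) :
    ∃ q : G.Walk c.snd r, q.IsPath ∧ (∀ x ∈ c.toSubgraph.verts, x ∈ q.support) ∧
      q.toSubgraph ≤ c.toSubgraph := by
  cases c with
  | nil => exact absurd hc (by simp)
  | cons h q =>
    rw [Walk.cons_isCycle_iff] at hc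
    have key : (Walk.cons h q).snd = _ := Walk.snd_cons q h
    rw [key]
    refine ⟨q, hc.1, ?_, ?_⟩
    · intro x hx
      rw [Walk.mem_verts_toSubgraph, Walk.support_cons, List.mem_cons] at hx
      rcases hx with rfl | hx
      · exact q.end_mem_support
      · exact hx
    · simp only [Walk.toSubgraph]
      exact le_sup_right

theorem cycle_path {V : Type u} {G : SimpleGraph V} {v r t : V} (c : G.Walk v v)
    (hc : c.IsCycle) (h : c.toSubgraph.Adj r t) :
    ∃ q : G.Walk t r, q.IsPath ∧ (∀ x ∈ c.toSubgraph.verts, x ∈ q.support) ∧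
      q.toSubgraph ≤ c.toSubgraph := by
  classical
  have hr : r ∈ c.support := by
    have := c.toSubgraph.edge_vert h
    rwa [Walk.mem_verts_toSubgraph] at this
  have hc' : (c.rotate r hr).IsCycle := hc.rotate hr
  have e : (c.rotate r hr).toSubgraph = c.toSubgraph := Walk.toSubgraph_rotate c hr
  rw [← e] at h ⊢
  generalize c.rotate r hr = d at *
  have hm : t ∈ d.toSubgraph.neighborSet r := h
  rw [hc'.neighborSet_toSubgraph_endpoint] at hm
  rcases hm with rfl | hm
  · exact cycle_path_snd d hc'
  · have hm : t = d.penultimate := hm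
    have h2 := cycle_path_snd d.reverse hc'.reverse
    rw [Walk.snd_reverse, Walk.toSubgraph_reverse, ← hm] at h2
    exact h2

/-- Rational-valued version of `IsStNumbering`. -/
def QSt {V : Type u} {G : SimpleGraph V} (H : G.Subgraph) (a b : V) (π : V → ℚ) : Prop :=
  a ∈ H.verts ∧ b ∈ H.verts ∧
  (∀ v ∈ H.verts, π a ≤ π v ∧ π v ≤ π b) ∧
  ∀ v ∈ H.verts, v ≠ a → v ≠ b →
    (∃ w, H.Adj v w ∧ π w < π v) ∧ (∃ w, H.Adj v w ∧ π v < π w)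

theorem QSt.congr {V : Type u} {G : SimpleGraph V} {H : G.Subgraph} {a b : V} {f g : V → ℚ}
    (h : QSt H a b f) (hfg : ∀ x ∈ H.verts, g x = f x) : QSt H a b g := by
  obtain ⟨ha, hb, h1, h2⟩ := h
  refine ⟨ha, hb, fun v hv => ?_, fun v hv hva hvb => ?_⟩
  · rw [hfg _ ha, hfg _ hb, hfg _ hv]; exact h1 v hv
  · obtain ⟨⟨w, hw, hl⟩, ⟨w', hw', hl'⟩⟩ := h2 v hv hva hvb
    refine ⟨⟨w, hw, ?_⟩, ⟨w', hw', ?_⟩⟩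
    · rw [hfg _ hv, hfg _ (H.edge_vert hw.symm)]; exact hl
    · rw [hfg _ hv, hfg _ (H.edge_vert hw'.symm)]; exact hl'

theorem QSt.sup_path {V : Type u} [Finite V] {G : SimpleGraph V} {H : G.Subgraph} {a b x y : V}
    {f : V → ℚ} (hf : Function.Injective f)
    (h : QSt H a b f) (p : G.Walk x y) (hp : p.IsPath) (hxy : x ≠ y)
    (hx : x ∈ H.verts) (hy : y ∈ H.verts)
    (hm : ∀ z ∈ p.support, z ∈ H.verts → z = x ∨ z = y) :
    ∃ g : V → ℚ, Function.Injective g ∧ (∀ z ∈ H.verts, g z = f z) ∧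
      QSt (H ⊔ p.toSubgraph) a b g := by
  obtain ⟨g, g1, g2, g3, g4⟩ := path_insert' p hp hxy f hf
  have hg : ∀ z ∈ H.verts, g z = f z := by
    intro z hz
    apply g2
    by_cases hzp : z ∈ p.support
    · exact Or.inr (hm z hzp hz)
    · exact Or.inl hzp
  obtain ⟨ha, hb, k1, k2⟩ := h.congr hg
  refine ⟨g, g1, hg, Or.inl ha, Or.inl hb, ?_, ?_⟩
  · intro v hv
    by_cases hvH : v ∈ H.verts
    · exact k1 v hvH
    · have hvp : v ∈ p.support := by
        rcases hv with hv | hv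
        · exact absurd hv hvH
        · rwa [Walk.mem_verts_toSubgraph] at hv
      have := g3 v hvp
      rw [← hg x hx, ← hg y hy] at this
      have hx1 := k1 x hx
      have hy1 := k1 y hy
      constructor
      · rcases this.1 with h | h <;> linarith
      · rcases this.2 with h | h <;> linarith
  · intro v hv hva hvb
    by_cases hvH : v ∈ H.verts
    · obtain ⟨⟨w, hw, hl⟩, ⟨w', hw', hl'⟩⟩ := k2 v hvH hva hvb
      exact ⟨⟨w, Or.inl hw, hl⟩, ⟨w', Or.inl hw', hl'⟩⟩
    · have hvp : v ∈ p.support := by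
        rcases hv with hv | hv
        · exact absurd hv hvH
        · rwa [Walk.mem_verts_toSubgraph] at hv
      obtain ⟨⟨w, hw, hl⟩, ⟨w', hw', hl'⟩⟩ := g4 v hvp
        (fun e => hvH (e ▸ hx)) (fun e => hvH (e ▸ hy))
      exact ⟨⟨w, Or.inr hw, hl⟩, ⟨w', Or.inr hw', hl'⟩⟩

theorem partialGraph_zero' {V : Type u} {G : SimpleGraph V} (D : EarDecomposition G) :
    D.partialGraph 0 = D.cycle.toSubgraph := by
  simp [EarDecomposition.partialGraph, EarDecomposition.ear]

theorem partialGraph_succ' {V : Type u} {G : SimpleGraph V} (D : EarDecomposition G) (i : ℕ)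
    (hi : i < D.k) :
    D.partialGraph (i + 1) = D.partialGraph i ⊔ (D.path ⟨i, hi⟩).toSubgraph := by
  have : D.ear (i + 1) = (D.path ⟨i, hi⟩).toSubgraph := by
    simp [EarDecomposition.ear, hi]
  rw [← this, EarDecomposition.partialGraph, Finset.range_add_one, Finset.iSup_insert, sup_comm]
  rfl

theorem mem_partialGraph {V : Type u} {G : SimpleGraph V} (D : EarDecomposition G) (x : V) :
    ∀ i ≤ D.k, (x ∈ (D.partialGraph i).verts ↔
      (x ∈ D.cycle.support ∨ ∃ j : Fin D.k, j.1 < i ∧ x ∈ (D.path j).support)) := by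
  intro i
  induction i with
  | zero => intro _; simp [partialGraph_zero']
  | succ i ih =>
    intro hi
    rw [partialGraph_succ' D i hi, Subgraph.verts_sup, Set.mem_union, ih (by omega),
      Walk.mem_verts_toSubgraph]
    constructor
    · rintro ((h | ⟨j, hj, h⟩) | h)
      · exact Or.inl h
      · exact Or.inr ⟨j, by omega, h⟩
      · exact Or.inr ⟨⟨i, hi⟩, by simp, h⟩
    · rintro (h | ⟨j, hj, h⟩)
      · exact Or.inl (Or.inl h)
      · by_cases hji : j.1 = i
        · right
          have : j = ⟨i, hi⟩ := Fin.ext hji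
          rwa [this] at h
        · exact Or.inl (Or.inr ⟨j, by omega, h⟩)

theorem partialGraph_mono' {V : Type u} {G : SimpleGraph V} (D : EarDecomposition G) {i j : ℕ}
    (h : i ≤ j) : D.partialGraph i ≤ D.partialGraph j := by
  unfold EarDecomposition.partialGraph
  exact biSup_mono (fun l hl => by simp at hl ⊢; omega)

theorem exists_QSt {V : Type u} [Finite V] {G : SimpleGraph V} (D : EarDecomposition G)
    (r t : V) (ht : s(t, r) ∈ D.earEdges 0) :
    ∀ i ≤ D.k, ∃ f : V → ℚ, Function.Injective f ∧ ∀ j ≤ i, QSt (D.partialGraph j) t r f := by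
  have hadj : D.cycle.toSubgraph.Adj t r := by
    have e : D.ear 0 = D.cycle.toSubgraph := by simp [EarDecomposition.ear]
    rw [EarDecomposition.earEdges, e] at ht
    exact ht
  intro i
  induction i with
  | zero =>
    intro _
    obtain ⟨q, hq, hv, hle⟩ := cycle_path D.cycle D.cycle_isCycle hadj.symm
    have htr : t ≠ r := hadj.ne
    obtain ⟨f, hf, hlt⟩ : ∃ f : V → ℚ, Function.Injective f ∧ f t < f r := by
      obtain ⟨n, ⟨e⟩⟩ := Finite.exists_equiv_fin V
      have hi : Function.Injective (fun v => ((e v : ℕ) : ℚ)) := by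
        intro x y hxy
        have : (e x : ℕ) = e y := Nat.cast_injective hxy
        exact e.injective (Fin.ext this)
      rcases lt_or_gt_of_ne (fun h => htr (hi h)) with h | h
      · exact ⟨_, hi, h⟩
      · exact ⟨fun v => -((e v : ℕ) : ℚ), fun x y hxy => hi (neg_injective hxy), neg_lt_neg h⟩
    obtain ⟨f', h1, h2, h3, h4, h5⟩ := path_insert q hq f hf hlt
    refine ⟨f', h1, fun j hj => ?_⟩
    obtain rfl : j = 0 := by omega
    rw [partialGraph_zero']
    refine ⟨D.cycle.toSubgraph.edge_vert hadj, D.cycle.toSubgraph.edge_vert hadj.symm, ?_, ?_⟩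
    · intro v hvv
      rw [h2 t (by simp), h2 r (by simp)]
      exact h3 v (hv v hvv)
    · intro v hvv hvt hvr
      obtain ⟨w, hw, hl⟩ := h4 v (hv v hvv) hvr
      obtain ⟨w', hw', hl'⟩ := h5 v (hv v hvv) hvt
      exact ⟨⟨w', hle.2 hw', hl'⟩, ⟨w, hle.2 hw, hl⟩⟩
  | succ i ih =>
    intro hi
    obtain ⟨f, hf, hst⟩ := ih (by omega)
    have hmem : ∀ z ∈ (D.path ⟨i, hi⟩).support, (z ∈ (D.partialGraph i).verts ↔
        (z = D.s ⟨i, hi⟩ ∨ z = D.t ⟨i, hi⟩)) := by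
      intro z hz
      rw [mem_partialGraph D z i (by omega), ← D.meets_prev ⟨i, hi⟩ z hz]
      rfl
    have hne : D.s ⟨i, hi⟩ ≠ D.t ⟨i, hi⟩ := by
      intro e
      have h0 := D.path_length_pos ⟨i, hi⟩
      have hp := D.path_isPath ⟨i, hi⟩
      have := path_length_zero _ hp e
      omega
    obtain ⟨g, g1, g2, g3⟩ := (hst i le_rfl).sup_path hf (D.path ⟨i, hi⟩) (D.path_isPath _) hne
      ((hmem _ (Walk.start_mem_support _)).2 (Or.inl rfl))
      ((hmem _ (Walk.end_mem_support _)).2 (Or.inr rfl))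
      (fun z hz => (hmem z hz).1)
    refine ⟨g, g1, fun j hj => ?_⟩
    by_cases hji : j = i + 1
    · rw [hji, partialGraph_succ' D i hi]; exact g3
    · have hji : j ≤ i := by omega
      exact (hst j hji).congr (fun x hx => g2 x ((partialGraph_mono' D hji).1 hx))

/-- Let `G` be a finite simple 3-connected graph, let `D` be a
Mondshein sequence of `G` avoiding an edge `ru`, and let `t ≠ u` be a neighbor of `r`
on the cycle `P₀`. Then there is an injective numbering of the vertices of `G` that is
a `tr`-numbering of the subgraph `Gᵢ` for every `0 ≤ i ≤ k` (a consistent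
`tr`-numbering). -/
theorem consistent_st_numbering {V : Type u} [Fintype V] (G : SimpleGraph V)
    (hG : KConnected 3 G) (r u t : V) (hru : G.Adj r u)
    (D : EarDecomposition G) (hD : IsMondshein D r u)
    (ht : s(t, r) ∈ D.earEdges 0) (htu : t ≠ u) :
    ∃ π : V → ℕ, Function.Injective π ∧
      ∀ i ≤ D.k, IsStNumbering (D.partialGraph i) t r π := by
  classical
  obtain ⟨f, hf, hst⟩ := exists_QSt D r t ht D.k le_rfl
  let π : V → ℕ := fun v => (Finset.univ.filter (fun w => f w < f v)).card
  have hlt : ∀ x y, f x < f y → π x < π y := by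
    intro x y h
    apply Finset.card_lt_card
    refine (Finset.ssubset_iff_of_subset ?_).2 ⟨x, by simpa using h, by simp⟩
    intro w hw
    simp only [Finset.mem_filter, Finset.mem_univ, true_and] at hw ⊢
    exact hw.trans h
  have hle : ∀ x y, f x ≤ f y → π x ≤ π y := by
    intro x y h
    rcases h.lt_or_eq with h | h
    · exact (hlt x y h).le
    · rw [hf h]
  refine ⟨π, ?_, ?_⟩
  · intro x y hxy
    by_contra hne
    rcases lt_or_gt_of_ne (fun e => hne (hf e)) with h | h
    · have := hlt _ _ h; omega
    · have := hlt _ _ h; omega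
  · intro i hi
    obtain ⟨ha, hb, h1, h2⟩ := hst i hi
    refine ⟨ha, hb, fun v hv => ⟨hle _ _ (h1 v hv).1, hle _ _ (h1 v hv).2⟩, ?_⟩
    intro v hv hvt hvr
    obtain ⟨⟨w, hw, hl⟩, ⟨w', hw', hl'⟩⟩ := h2 v hv hvt hvr
    exact ⟨⟨w, hw, hlt _ _ hl⟩, ⟨w', hw', hlt _ _ hl'⟩⟩
end

section
/- Let G be a finite simple 3-connected graph, let D be a Mondshein sequence of G avoiding an edge ru, and let t be a neighbor of r on the cycle P_0 with t ≠ u. Then for every vertex x of G with x ∉ {r,t}, there exist two internally vertex-disjoint paths in G, one from x to r and one from x to t, all of whose vertices lie in the subgraph G_{birth(x)}. -/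
open SimpleGraph

universe u

variable {V : Type u}

/-- `f` is an st-numbering (from `r` to `t`) of the vertex set `S`. -/
structure STGood {V : Type u} (G : SimpleGraph V) (r t : V) (S : Set V) (f : V → ℚ) : Prop where
  inj : Set.InjOn f S
  down : ∀ v ∈ S, v ≠ r → ∃ w ∈ S, G.Adj v w ∧ f w < f v
  up : ∀ v ∈ S, v ≠ t → ∃ w ∈ S, G.Adj v w ∧ f v < f w

theorem STGood.descend {V : Type u} [Finite V] {G : SimpleGraph V} (r : V) (S : Set V) (f : V → ℚ)
    (down : ∀ v ∈ S, v ≠ r → ∃ w ∈ S, G.Adj v w ∧ f w < f v) (x : V) (hx : x ∈ S) :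
    ∃ p : G.Walk x r, p.IsPath ∧ ∀ v ∈ p.support, v ∈ S ∧ (v = x ∨ f v < f x) := by
  have wf : WellFounded (fun a b : V => f a < f b) := by
    have : IsTrans V (fun a b : V => f a < f b) := ⟨fun a b c => lt_trans⟩
    have : Std.Irrefl (fun a b : V => f a < f b) := ⟨fun a => lt_irrefl _⟩
    exact Finite.wellFounded_of_trans_of_irrefl _
  induction x using wf.induction with
  | _ x ih =>
    by_cases hxr : x = r
    · subst hxr
      exact ⟨Walk.nil, by simp, by simpa using hx⟩
    · obtain ⟨w, hwS, hadj, hlt⟩ := down x hx hxr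
      obtain ⟨p, hp, hps⟩ := ih w hlt hwS
      have key : ∀ v ∈ p.support, f v < f x := by
        intro v hv
        rcases (hps v hv).2 with h | h
        · rw [h]; exact hlt
        · exact h.trans hlt
      refine ⟨Walk.cons hadj p, ?_, ?_⟩
      · rw [Walk.cons_isPath_iff]
        exact ⟨hp, fun h => lt_irrefl _ (key x h)⟩
      · intro v hv
        rw [Walk.support_cons, List.mem_cons] at hv
        rcases hv with h | h
        · exact ⟨h ▸ hx, Or.inl h⟩
        · exact ⟨(hps v h).1, Or.inr (key v h)⟩

theorem STGood.ear_aux {V : Type u} [Finite V] {G : SimpleGraph V} {r t : V} {S : Set V} {f : V → ℚ}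
    (h : STGood G r t S f) {a b : V} (p : G.Walk a b) (hp : p.IsPath)
    (ha : a ∈ S) (hb : b ∈ S) (hm : ∀ v ∈ p.support, v ∈ S → v = a ∨ v = b) (hab : f a < f b) :
    ∃ f', STGood G r t (S ∪ {v | v ∈ p.support}) f' := by
  classical
  obtain ⟨m, hm1, hm2⟩ : ∃ m, f a < m ∧ ∀ v, f a < f v → m ≤ f v := by
    obtain ⟨v, hv, hmin⟩ := Set.exists_min_image {v | f a < f v} f (Set.toFinite _) ⟨b, hab⟩
    exact ⟨f v, hv, hmin⟩
  have hidx : ∀ v, ∃ n, v ∈ p.support → p.getVert n = v ∧ n ≤ p.length := by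
    intro v
    by_cases hv : v ∈ p.support
    · obtain ⟨n, hn⟩ := Walk.mem_support_iff_exists_getVert.1 hv
      exact ⟨n, fun _ => hn⟩
    · exact ⟨0, fun h => absurd h hv⟩
  choose e he using hidx
  have hinj := hp.getVert_injOn
  have hget : ∀ n ≤ p.length, e (p.getVert n) = n := by
    intro n hn
    obtain ⟨h1, h2⟩ := he (p.getVert n) (p.getVert_mem_support n)
    exact hinj h2 hn h1
  have hne : a ≠ b := fun h => by rw [h] at hab; exact lt_irrefl _ hab
  have hlen : 0 < p.length := by
    rcases Nat.eq_zero_or_pos p.length with h0 | h0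
    · exact absurd (Walk.eq_of_length_eq_zero h0) hne
    · exact h0
  have hlenQ : (0 : ℚ) < p.length := by exact_mod_cast hlen
  let g : ℕ → ℚ := fun n => f a + (m - f a) * (n / p.length)
  have hgmono : ∀ i j, i < j → g i < g j := by
    intro i j hij
    have : (i : ℚ) < j := by exact_mod_cast hij
    have h1 : (i : ℚ) / p.length < j / p.length := by gcongr
    have h2 : 0 < m - f a := by linarith
    simp only [g]
    nlinarith
  have hg0 : g 0 = f a := by simp [g]
  have hgl : g p.length = m := by simp only [g]; field_simp; ring
  let f' : V → ℚ := fun v => if v ∈ S then f v else g (e v)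
  have hS : ∀ v ∈ S, f' v = f v := fun v hv => by simp [f', hv]
  have hN : ∀ v, v ∉ S → f' v = g (e v) := fun v hv => by simp [f', hv]
  have hin : ∀ n, 0 < n → n < p.length → p.getVert n ∉ S := by
    intro n h0 h1 hs
    rcases hm _ (p.getVert_mem_support n) hs with h | h
    · have := hget n h1.le
      have h2 := hget 0 (Nat.zero_le _)
      rw [h] at this
      rw [Walk.getVert_zero] at h2
      omega
    · have := hget n h1.le
      have h2 := hget _ (le_refl p.length)
      rw [h] at this
      rw [Walk.getVert_length] at h2
      omega
  have hpos : ∀ v ∈ p.support, v ∉ S → p.getVert (e v) = v ∧ 0 < e v ∧ e v < p.length := by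
    intro v hv hvS
    obtain ⟨h1, h2⟩ := he v hv
    refine ⟨h1, ?_, ?_⟩
    · rcases Nat.eq_zero_or_pos (e v) with h0 | h0
      · rw [h0, Walk.getVert_zero] at h1
        exact absurd (h1 ▸ ha) hvS
      · exact h0
    · rcases h2.lt_or_eq with h0 | h0
      · exact h0
      · rw [h0, Walk.getVert_length] at h1
        exact absurd (h1 ▸ hb) hvS
  have hval : ∀ n, n < p.length → f' (p.getVert n) = g n := by
    intro n hn
    rcases Nat.eq_zero_or_pos n with h0 | h0
    · subst h0
      rw [Walk.getVert_zero, hS a ha, hg0]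
    · rw [hN _ (hin n h0 hn), hget n hn.le]
  have hval' : ∀ n, n ≤ p.length → g n ≤ f' (p.getVert n) := by
    intro n hn
    rcases hn.lt_or_eq with h0 | h0
    · exact (hval n h0).ge
    · rw [h0, Walk.getVert_length, hS b hb, hgl]
      exact hm2 b hab
  have hmix : ∀ v ∈ S, ∀ w ∈ p.support, w ∉ S → f' v ≠ f' w := by
    intro v hv w hw hwS heq
    obtain ⟨-, h1, h2⟩ := hpos w hw hwS
    rw [hS v hv, hN w hwS] at heq
    have h3 := hgmono _ _ h1
    have h4 := hgmono _ _ h2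
    rw [hg0, ← heq] at h3
    rw [hgl, ← heq] at h4
    exact absurd (hm2 v h3) (not_le.2 h4)
  refine ⟨f', ⟨?_, ?_, ?_⟩⟩
  · intro v hv w hw heq
    by_cases hvS : v ∈ S <;> by_cases hwS : w ∈ S
    · rw [hS v hvS, hS w hwS] at heq
      exact h.inj hvS hwS heq
    · exact absurd heq (hmix v hvS w (hw.resolve_left hwS) hwS)
    · exact absurd heq.symm (hmix w hwS v (hv.resolve_left hvS) hvS)
    · rw [hN v hvS, hN w hwS] at heq
      have : e v = e w := by
        rcases lt_trichotomy (e v) (e w) with h1 | h1 | h1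
        · exact absurd heq (hgmono _ _ h1).ne
        · exact h1
        · exact absurd heq (hgmono _ _ h1).ne'
      rw [← (hpos v (hv.resolve_left hvS) hvS).1, ← (hpos w (hw.resolve_left hwS) hwS).1, this]
  · intro v hv hvr
    by_cases hvS : v ∈ S
    · obtain ⟨w, hw, h1, h2⟩ := h.down v hvS hvr
      exact ⟨w, Or.inl hw, h1, by rwa [hS v hvS, hS w hw]⟩
    · obtain ⟨h1, h2, h3⟩ := hpos v (hv.resolve_left hvS) hvS
      refine ⟨p.getVert (e v - 1), Or.inr (p.getVert_mem_support _), ?_, ?_⟩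
      · have := p.adj_getVert_succ (i := e v - 1) (by omega)
        rw [Nat.sub_add_cancel h2, h1] at this
        exact this.symm
      · rw [hval _ (by omega), hN v hvS]
        exact hgmono _ _ (by omega)
  · intro v hv hvt
    by_cases hvS : v ∈ S
    · obtain ⟨w, hw, h1, h2⟩ := h.up v hvS hvt
      exact ⟨w, Or.inl hw, h1, by rwa [hS v hvS, hS w hw]⟩
    · obtain ⟨h1, h2, h3⟩ := hpos v (hv.resolve_left hvS) hvS
      refine ⟨p.getVert (e v + 1), Or.inr (p.getVert_mem_support _), ?_, ?_⟩
      · have := p.adj_getVert_succ (i := e v) h3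
        rwa [h1] at this
      · rw [hN v hvS]
        exact (hgmono _ _ (Nat.lt_succ_self _)).trans_le (hval' _ h3)

theorem STGood.ear {V : Type u} [Finite V] {G : SimpleGraph V} {r t : V} {S : Set V} {f : V → ℚ}
    (h : STGood G r t S f) {a b : V} (p : G.Walk a b) (hp : p.IsPath) (hne : a ≠ b)
    (ha : a ∈ S) (hb : b ∈ S) (hm : ∀ v ∈ p.support, v ∈ S → v = a ∨ v = b) :
    ∃ f', STGood G r t (S ∪ {v | v ∈ p.support}) f' := by
  rcases lt_trichotomy (f a) (f b) with h1 | h1 | h1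
  · exact h.ear_aux p hp ha hb hm h1
  · exact absurd (h.inj ha hb h1) hne
  · have := h.ear_aux p.reverse hp.reverse hb ha
      (fun v hv hvS => (hm v (by simpa using hv) hvS).symm) h1
    simpa using this

theorem cycle_to_path {V : Type u} {G : SimpleGraph V} {v0 r t : V} (c : G.Walk v0 v0)
    (hc : c.IsCycle) (he : s(t, r) ∈ c.edges) :
    ∃ p : G.Walk r t, p.IsPath ∧ ∀ v, v ∈ p.support ↔ v ∈ c.support := by
  classical
  have hr : r ∈ c.support := c.snd_mem_support_of_mem_edges he
  have hsup : ∀ v, v ∈ (c.rotate r hr).support ↔ v ∈ c.support := by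
    intro v
    exact Walk.mem_support_rotate_iff c r hr
  have hc' := hc.rotate hr
  have he' : s(t, r) ∈ (c.rotate r hr).edges := (c.rotate_edges r hr).mem_iff.2 he
  simp only [← hsup]
  generalize c.rotate r hr = c' at hc' he'
  clear hsup
  cases c' with
  | nil => simp at he'
  | @cons _ w _ hadj q =>
    rw [Walk.cons_isCycle_iff] at hc'
    obtain ⟨hq, hnot⟩ := hc'
    by_cases hwt : w = t
    · subst hwt
      refine ⟨q.reverse, hq.reverse, fun v => ?_⟩
      simp only [Walk.support_reverse, List.mem_reverse, Walk.support_cons, List.mem_cons]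
      constructor
      · exact Or.inr
      · rintro (h | h)
        · rw [h]; exact q.end_mem_support
        · exact h
    · have hq' := hq.reverse
      have he2 : s(t, r) ∈ q.reverse.edges := by
        rw [Walk.edges_cons, List.mem_cons] at he'
        rcases he' with h | h
        · rw [Sym2.eq_iff] at h
          rcases h with ⟨h1, h2⟩ | ⟨h1, h2⟩
          · exact absurd (h2.symm) (h1 ▸ hwt)
          · exact absurd h1.symm hwt
        · simpa using h
      have hs : ∀ v, v ∈ (Walk.cons hadj q).support ↔ v ∈ q.reverse.support := by
        intro v
        simp only [Walk.support_reverse, List.mem_reverse, Walk.support_cons, List.mem_cons]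
        constructor
        · rintro (h | h)
          · rw [h]; exact q.end_mem_support
          · exact h
        · exact Or.inr
      simp only [hs]
      clear hs
      generalize q.reverse = q' at hq' he2
      cases q' with
      | nil => simp at he2
      | @cons _ w' _ hadj' q2 =>
        rw [Walk.cons_isPath_iff] at hq'
        rw [Walk.edges_cons, List.mem_cons] at he2
        have hw' : w' = t := by
          rcases he2 with h | h
          · rw [Sym2.eq_iff] at h
            rcases h with ⟨h1, h2⟩ | ⟨h1, h2⟩
            · exact h2.symm.trans h1.symm
            · exact h1.symm
          · exact absurd (q2.snd_mem_support_of_mem_edges h) hq'.2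
        subst hw'
        refine ⟨Walk.cons hadj q2.reverse, ?_, ?_⟩
        · rw [Walk.cons_isPath_iff]
          exact ⟨hq'.1.reverse, by simpa using hq'.2⟩
        · intro v; simp

namespace EarDecomposition

theorem partialGraph_verts {V : Type u} {G : SimpleGraph V} (D : EarDecomposition G) (n : ℕ) (v : V) :
    v ∈ (D.partialGraph n).verts ↔ ∃ j ≤ n, v ∈ D.earSupport j := by
  simp [partialGraph, earSupport, Nat.lt_succ_iff]

theorem mem_earSupport_zero {V : Type u} {G : SimpleGraph V} (D : EarDecomposition G) (v : V) :
    v ∈ D.earSupport 0 ↔ v ∈ D.cycle.support := by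
  simp [earSupport, ear]

theorem mem_earSupport_succ {V : Type u} {G : SimpleGraph V} (D : EarDecomposition G) (n : ℕ) (v : V) :
    v ∈ D.earSupport (n + 1) ↔ ∃ h : n < D.k, v ∈ (D.path ⟨n, h⟩).support := by
  by_cases h : n < D.k <;> simp [earSupport, ear, h]

theorem exists_good {V : Type u} [Finite V] {G : SimpleGraph V} (D : EarDecomposition G) (r t : V)
    (ht : s(t, r) ∈ D.earEdges 0) (n : ℕ) :
    ∃ f, STGood G r t (D.partialGraph n).verts f := by
  induction n with
  | zero =>
    have he : s(t, r) ∈ D.cycle.edges := by simpa [earEdges, ear] using ht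
    have hadj : G.Adj t r := D.cycle.adj_of_mem_edges he
    obtain ⟨p, hp, hps⟩ := cycle_to_path D.cycle D.cycle_isCycle he
    classical
    have h0 : STGood G r t {r, t} (fun v => if v = r then 0 else 1) := by
      have hne := hadj.ne
      refine ⟨?_, ?_, ?_⟩
      · rintro v (rfl | rfl) w (rfl | rfl) <;> simp [hne]
      · rintro v (rfl | rfl) h
        · exact absurd rfl h
        · exact ⟨r, by simp, hadj, by simp [hne]⟩
      · rintro v (rfl | rfl) h
        · exact ⟨t, by simp, hadj.symm, by simp [hne]⟩
        · exact absurd rfl h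
    obtain ⟨f, hf⟩ := h0.ear p hp hadj.ne' (by simp) (by simp) (fun v _ hv => by simpa using hv)
    refine ⟨f, ?_⟩
    convert hf using 1
    ext v
    rw [partialGraph_verts]
    simp only [Nat.le_zero, exists_eq_left, mem_earSupport_zero, ← hps, Set.mem_union,
      Set.mem_insert_iff, Set.mem_singleton_iff, Set.mem_setOf_eq]
    constructor
    · exact Or.inr
    · rintro ((h | h) | h)
      · rw [h]; exact p.start_mem_support
      · rw [h]; exact p.end_mem_support
      · exact h
  | succ n ih =>
    obtain ⟨f, hf⟩ := ih
    have hstep : ∀ v, v ∈ (D.partialGraph (n + 1)).verts ↔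
        v ∈ (D.partialGraph n).verts ∨ v ∈ D.earSupport (n + 1) := by
      intro v
      simp only [partialGraph_verts]
      constructor
      · rintro ⟨j, hj, hv⟩
        rcases hj.lt_or_eq with h | h
        · exact Or.inl ⟨j, by omega, hv⟩
        · exact Or.inr (h ▸ hv)
      · rintro (⟨j, hj, hv⟩ | hv)
        · exact ⟨j, by omega, hv⟩
        · exact ⟨n + 1, le_rfl, hv⟩
    by_cases hn : n < D.k
    · set i : Fin D.k := ⟨n, hn⟩ with hi
      have hprev : ∀ v, v ∈ (D.partialGraph n).verts ↔
          (v ∈ D.cycle.support ∨ ∃ j, j < i ∧ v ∈ (D.path j).support) := by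
        intro v
        rw [partialGraph_verts]
        constructor
        · rintro ⟨j, hj, hv⟩
          cases j with
          | zero => exact Or.inl ((D.mem_earSupport_zero v).1 hv)
          | succ j =>
            obtain ⟨hk, hv⟩ := (D.mem_earSupport_succ j v).1 hv
            exact Or.inr ⟨⟨j, hk⟩, by simp [hi, Fin.lt_def]; omega, hv⟩
        · rintro (hv | ⟨j, hj, hv⟩)
          · exact ⟨0, Nat.zero_le _, (D.mem_earSupport_zero v).2 hv⟩
          · exact ⟨j + 1, by simp [hi, Fin.lt_def] at hj; omega,
              (D.mem_earSupport_succ j v).2 ⟨j.2, hv⟩⟩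
      have hne : D.s i ≠ D.t i := by
        intro h
        have h1 := D.path_isPath i
        have h2 := D.path_length_pos i
        have h3 := h1.getVert_injOn (Set.mem_setOf.2 (Nat.zero_le _)) (Set.mem_setOf.2 le_rfl)
          (by rw [Walk.getVert_zero, Walk.getVert_length, h])
        omega
      obtain ⟨f', hf'⟩ := hf.ear (D.path i) (D.path_isPath i) hne
        ((hprev _).2 ((D.meets_prev i _ (Walk.start_mem_support _)).2 (Or.inl rfl)))
        ((hprev _).2 ((D.meets_prev i _ (Walk.end_mem_support _)).2 (Or.inr rfl)))
        (fun v hv hvS => (D.meets_prev i v hv).1 ((hprev v).1 hvS))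
      refine ⟨f', ?_⟩
      convert hf' using 1
      ext v
      rw [hstep, mem_earSupport_succ]
      simp only [hn, exists_true_left]; rfl
    · refine ⟨f, ?_⟩
      convert hf using 1
      ext v
      rw [hstep, mem_earSupport_succ]
      simp [hn]

theorem mem_birth {V : Type u} {G : SimpleGraph V} (D : EarDecomposition G) {x y : V}
    (h : G.Adj x y) : x ∈ D.earSupport (D.birth x) := by
  apply Nat.sInf_mem (s := {i | x ∈ D.earSupport i})
  rcases D.edges_cover s(x, y) h with h1 | ⟨i, h1⟩
  · exact ⟨0, (D.mem_earSupport_zero x).2 (Walk.fst_mem_support_of_mem_edges _ h1)⟩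
  · exact ⟨i + 1, (D.mem_earSupport_succ i x).2 ⟨i.2, Walk.fst_mem_support_of_mem_edges _ h1⟩⟩

end EarDecomposition

/-- Let `G` be a finite simple 3-connected graph, let `D` be a
Mondshein sequence of `G` avoiding an edge `ru`, and let `t ≠ u` be a neighbor of `r` on
the cycle `P₀`. Then for every vertex `x ∉ {r, t}` of `G` there are two internally
vertex-disjoint paths in `G`, one from `x` to `r` and one from `x` to `t`, all of whose
vertices lie in the subgraph `G_{birth x}`. -/
theorem two_disjoint_paths_in_partialGraph {V : Type u} [Fintype V] (G : SimpleGraph V)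
    (hG : KConnected 3 G) (r u t : V) (hru : G.Adj r u)
    (D : EarDecomposition G) (hD : IsMondshein D r u)
    (ht : s(t, r) ∈ D.earEdges 0) (htu : t ≠ u) :
    ∀ x : V, x ≠ r → x ≠ t →
      ∃ (p : G.Walk x r) (q : G.Walk x t), p.IsPath ∧ q.IsPath ∧
        (∀ v ∈ p.support, v ∈ (D.partialGraph (D.birth x)).verts) ∧
        (∀ v ∈ q.support, v ∈ (D.partialGraph (D.birth x)).verts) ∧
        (∀ v ∈ p.support, v ∈ q.support → v = x) := by
  intro x hxr hxt
  have hadj : ∃ y, G.Adj x y := by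
    have hc := hG.2 ∅ (by simp)
    obtain ⟨w⟩ := hc.preconnected ⟨x, by simp⟩ ⟨r, by simp⟩
    cases w with
    | nil => exact absurd rfl hxr
    | cons h _ => exact ⟨_, h⟩
  obtain ⟨y, hy⟩ := hadj
  have hx : x ∈ (D.partialGraph (D.birth x)).verts :=
    (D.partialGraph_verts _ _).2 ⟨_, le_rfl, D.mem_birth hy⟩
  obtain ⟨f, hf⟩ := D.exists_good r t ht (D.birth x)
  obtain ⟨p, hp, hps⟩ := STGood.descend r _ f hf.down x hx
  obtain ⟨q, hq, hqs⟩ := STGood.descend t _ (fun v => - f v)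
    (fun v hv hvt => by simpa using hf.up v hv hvt) x hx
  refine ⟨p, q, hp, hq, fun v hv => (hps v hv).1, fun v hv => (hqs v hv).1, fun v hv hv' => ?_⟩
  rcases (hps v hv).2 with h | h
  · exact h
  · rcases (hqs v hv').2 with h' | h'
    · exact h'
    · exact absurd (neg_lt_neg_iff.1 h') (lt_asymm h)
end

section
/- Every finite simple 3-connected graph G contains three independent spanning trees; moreover, for every vertex r of G, there exist three independent spanning trees of G all rooted at r. -/
open SimpleGraph

universe u

variable {V : Type u}

/-- `T` is a spanning tree of `G` (given as a subgraph of `G`). -/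
def IsSpanningTreeSub (G : SimpleGraph V) (T : G.Subgraph) : Prop :=
  T.verts = Set.univ ∧ T.coe.IsTree

/-- Two spanning trees `T` and `T'` of `G`, both rooted at `r`, are independent: for
every vertex `x ≠ r`, the `r,x`-paths in `T` and in `T'` are internally
vertex-disjoint, i.e. they share no vertices other than `r` and `x`. -/
def IndepPair {G : SimpleGraph V} (T T' : G.Subgraph) (r : V) : Prop :=
  ∀ x : V, x ≠ r → ∀ (p q : G.Walk r x), p.IsPath → q.IsPath →
    (∀ e ∈ p.edges, e ∈ T.edgeSet) → (∀ e ∈ q.edges, e ∈ T'.edgeSet) →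
    ∀ v ∈ p.support, v ∈ q.support → v = r ∨ v = x


namespace ThreeTrees

variable {V : Type u}

/-- Reachability inside a set. -/
def R (G : SimpleGraph V) (S : Set V) : V → V → Prop :=
  Relation.ReflTransGen (fun p q => G.Adj p q ∧ p ∈ S ∧ q ∈ S)

theorem R.symm {G : SimpleGraph V} {S : Set V} {x y : V} (h : R G S x y) : R G S y x := by
  induction h with
  | refl => exact Relation.ReflTransGen.refl
  | tail _ h2 ih => exact Relation.ReflTransGen.head ⟨h2.1.symm, h2.2.2, h2.2.1⟩ ih

theorem R.mono {G : SimpleGraph V} {S T : Set V} (hST : S ⊆ T) {x y : V} (h : R G S x y) :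
    R G T x y := by
  induction h with
  | refl => exact Relation.ReflTransGen.refl
  | tail _ h2 ih => exact Relation.ReflTransGen.tail ih ⟨h2.1, hST h2.2.1, hST h2.2.2⟩

theorem R.trans {G : SimpleGraph V} {S : Set V} {x y z : V} (h : R G S x y) (h' : R G S y z) :
    R G S x z := Relation.ReflTransGen.trans h h'

theorem R.step {G : SimpleGraph V} {S : Set V} {x y : V} (h : G.Adj x y) (hx : x ∈ S)
    (hy : y ∈ S) : R G S x y := Relation.ReflTransGen.single ⟨h, hx, hy⟩

theorem R.refl {G : SimpleGraph V} {S : Set V} (x : V) : R G S x x :=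
  Relation.ReflTransGen.refl

/-- A reachability walk from `K` to its complement crosses the boundary. -/
theorem R.cross {G : SimpleGraph V} {S K : Set V} {x y : V} (h : R G S x y) (hx : x ∈ K)
    (hy : y ∉ K) : ∃ p ∈ K, ∃ q, q ∉ K ∧ G.Adj p q ∧ p ∈ S ∧ q ∈ S := by
  induction h with
  | refl => exact absurd hx hy
  | @tail b c _ h2 ih =>
    by_cases hb : b ∈ K
    · exact ⟨b, hb, c, hy, h2⟩
    · exact ih hb

theorem R.exists_walk {G : SimpleGraph V} {S : Set V} {x y : V} (h : R G S x y) (hx : x ∈ S) :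
    ∃ p : G.Walk x y, ∀ v ∈ p.support, v ∈ S := by
  induction h with
  | refl => exact ⟨.nil, by simpa using hx⟩
  | tail _ h2 ih =>
    obtain ⟨p, hp⟩ := ih
    refine ⟨p.concat h2.1, ?_⟩
    intro v hv
    rw [Walk.support_concat] at hv
    simp only [List.mem_append, List.mem_singleton, List.concat_eq_append] at hv
    rcases hv with hv | rfl
    · exact hp v hv
    · exact h2.2.2

/-- Connectedness of an induced graph gives reachability. -/
theorem R.of_induce {G : SimpleGraph V} {S : Set V} (h : (G.induce S).Connected) {x y : V}
    (hx : x ∈ S) (hy : y ∈ S) : R G S x y := by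
  obtain ⟨p⟩ := h.preconnected ⟨x, hx⟩ ⟨y, hy⟩
  have key : ∀ (a b : S) (p : (G.induce S).Walk a b), R G S a b := by
    intro a b p
    induction p with
    | nil => exact R.refl _
    | @cons u v w h p ih => exact (R.step (by simpa using h) u.2 v.2).trans ih
  exact key _ _ p

/-- The component of `x` in `S`. -/
def comp (G : SimpleGraph V) (S : Set V) (x : V) : Set V := {y | y ∈ S ∧ R G S x y}

theorem mem_comp_of_adj {G : SimpleGraph V} {S : Set V} {x y z : V} (hy : y ∈ comp G S x)
    (hz : z ∈ S) (h : G.Adj y z) : z ∈ comp G S x :=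
  ⟨hz, hy.2.trans (R.step h hy.1 hz)⟩

theorem R_comp {G : SimpleGraph V} {S : Set V} {x y : V} (hx : x ∈ S) (h : R G S x y) :
    R G (comp G S x) x y := by
  induction h with
  | refl => exact R.refl _
  | tail h1 h2 ih =>
    exact ih.trans (R.step h2.1 ⟨h2.2.1, h1⟩ ⟨h2.2.2, h1.tail h2⟩)

theorem R_comp' {G : SimpleGraph V} {S : Set V} {x y z : V} (hx : x ∈ S)
    (hy : y ∈ comp G S x) (hz : z ∈ comp G S x) : R G (comp G S x) y z :=
  (R_comp hx hy.2).symm.trans (R_comp hx hz.2)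

/-- The consequence of 3-connectivity which we use. -/
theorem cut [Fintype V] {G : SimpleGraph V} (hG : KConnected 3 G) {K : Set V} {k z p q : V}
    (hk : k ∈ K) (hz : z ∉ K) (hp : p ∉ K) (hq : q ∉ K) (hzp : z ≠ p) (hzq : z ≠ q) :
    ∃ x ∈ K, ∃ y, y ∉ K ∧ G.Adj x y ∧ y ≠ p ∧ y ≠ q := by
  have hc := hG.2 {p, q} (lt_of_le_of_lt (Set.ncard_insert_le _ _) (by simp))
  have hR := R.of_induce hc (x := k) (y := z)
    (by rintro (rfl | h)
        · exact hp hk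
        · rw [Set.mem_singleton_iff] at h; subst h; exact hq hk)
    (by rintro (rfl | h)
        · exact hzp rfl
        · exact hzq h)
  obtain ⟨x, hx, y, hy, h, -, h'⟩ := hR.cross hk hz
  refine ⟨x, hx, y, hy, h, ?_, ?_⟩
  · rintro rfl; exact h' (by simp)
  · rintro rfl; exact h' (by simp)

/-- `P` is ordered by `f` consistently between `a` and `b`. -/
def StOrd (G : SimpleGraph V) (P : Set V) (a b : V) (f : V → ℚ) : Prop :=
  (∀ x ∈ P, ∀ y ∈ P, f x = f y → x = y) ∧
  (∀ p ∈ P, G.Adj p a ∨ ∃ q ∈ P, G.Adj p q ∧ f q < f p) ∧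
  (∀ p ∈ P, G.Adj p b ∨ ∃ q ∈ P, G.Adj p q ∧ f p < f q)

theorem StOrd.swap {G : SimpleGraph V} {P : Set V} {a b : V} {f : V → ℚ}
    (h : StOrd G P a b f) : StOrd G P b a (fun x => - f x) := by
  refine ⟨fun x hx y hy e => h.1 x hx y hy (neg_injective e), ?_, ?_⟩
  · intro p hp
    rcases h.2.2 p hp with h | ⟨q, hq, h1, h2⟩
    · exact .inl h
    · exact .inr ⟨q, hq, h1, neg_lt_neg h2⟩
  · intro p hp
    rcases h.2.1 p hp with h | ⟨q, hq, h1, h2⟩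
    · exact .inl h
    · exact .inr ⟨q, hq, h1, neg_lt_neg h2⟩

/-- Induction along a rational valued function on a finite type. -/
theorem fin_induct [Finite V] (f : V → ℚ) {C : V → Prop}
    (h : ∀ x, (∀ y, f y < f x → C y) → C x) (x : V) : C x := by
  have : IsTrans V (fun x y => f x < f y) := ⟨fun _ _ _ => lt_trans⟩
  have : Std.Irrefl (fun x y : V => f x < f y) := ⟨fun _ => lt_irrefl _⟩
  exact (Finite.wellFounded_of_trans_of_irrefl (fun x y : V => f x < f y)).induction x h

theorem StOrd.lowPart [Finite V] {G : SimpleGraph V} {P : Set V} {a b : V} {f : V → ℚ}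
    (h : StOrd G P a b f) (w : V) (hw : w ∈ P) :
    ∃ x ∈ P, f x ≤ f w ∧ G.Adj x a ∧ R G {q | q ∈ P ∧ f q ≤ f w} x w := by
  revert hw
  refine fin_induct f (C := fun w => w ∈ P → ∃ x ∈ P, f x ≤ f w ∧ G.Adj x a ∧
    R G {q | q ∈ P ∧ f q ≤ f w} x w) ?_ w
  intro w ih hw
  rcases h.2.1 w hw with h1 | ⟨q, hq, h1, h2⟩
  · exact ⟨w, hw, le_rfl, h1, R.refl _⟩
  · obtain ⟨x, hx, hxq, hxa, hR⟩ := ih q h2 hq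
    refine ⟨x, hx, hxq.trans h2.le, hxa, ?_⟩
    have hsub : {z | z ∈ P ∧ f z ≤ f q} ⊆ {z | z ∈ P ∧ f z ≤ f w} :=
      fun y hy => ⟨hy.1, hy.2.trans h2.le⟩
    exact (hR.mono hsub).trans
      (R.step h1.symm ⟨hq, h2.le⟩ ⟨hw, le_rfl⟩)

theorem StOrd.highPart [Finite V] {G : SimpleGraph V} {P : Set V} {a b : V} {f : V → ℚ}
    (h : StOrd G P a b f) (w : V) (hw : w ∈ P) :
    ∃ x ∈ P, f w ≤ f x ∧ G.Adj x b ∧ R G {q | q ∈ P ∧ f w ≤ f q} x w := by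
  simpa using h.swap.lowPart w hw

/-- `X` contains the interior of a path between distinct vertices of `A`. -/
def Good (G : SimpleGraph V) (A X : Set V) : Prop :=
  ∃ a ∈ A, ∃ b ∈ A, a ≠ b ∧ ∃ x ∈ X, ∃ y ∈ X, G.Adj x a ∧ G.Adj y b ∧ R G X x y

theorem exists_stOrd {G : SimpleGraph V} {X : Set V} {a b x y : V} (hx : x ∈ X)
    (hxa : G.Adj x a) (hyb : G.Adj y b) (h : R G X x y) :
    ∃ P ⊆ X, ∃ f, P.Nonempty ∧ StOrd G P a b f := by
  classical
  obtain ⟨p0, hp0⟩ := h.exists_walk hx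
  obtain ⟨p, hp, hpX⟩ : ∃ p : G.Walk x y, p.IsPath ∧ ∀ v ∈ p.support, v ∈ X :=
    ⟨p0.bypass, p0.bypass_isPath, fun v hv => hp0 v (p0.support_bypass_subset_support hv)⟩
  have hidx : ∀ i ≤ p.length, p.support.idxOf (p.getVert i) = i := by
    intro i hi
    rw [Walk.getVert_eq_support_getElem _ hi]
    exact hp.support_nodup.idxOf_getElem _ _
  have hmem : ∀ v ∈ p.support, ∃ i ≤ p.length, p.getVert i = v := by
    intro v hv
    obtain ⟨i, h1, h2⟩ := Walk.mem_support_iff_exists_getVert.1 hv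
    exact ⟨i, h2, h1⟩
  refine ⟨{v | v ∈ p.support}, hpX, fun v => (p.support.idxOf v : ℚ), ⟨x, by simp⟩, ?_, ?_, ?_⟩
  · intro v hv w hw e
    simp only at e
    have e' : p.support.idxOf v = p.support.idxOf w := by exact_mod_cast e
    exact (List.idxOf_inj hv).1 e'
  · intro v hv
    obtain ⟨i, hi, rfl⟩ := hmem v hv
    rcases i with _ | i
    · left; simpa using hxa
    · right
      refine ⟨p.getVert i, p.getVert_mem_support i, (p.adj_getVert_succ (by omega)).symm, ?_⟩
      simp only [hidx _ hi, hidx i (by omega)]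
      push_cast; linarith
  · intro v hv
    obtain ⟨i, hi, rfl⟩ := hmem v hv
    rcases hi.lt_or_eq with hi' | rfl
    · right
      refine ⟨p.getVert (i+1), p.getVert_mem_support _, p.adj_getVert_succ hi', ?_⟩
      simp only [hidx _ hi, hidx _ hi']
      push_cast; linarith
    · left; simpa using hyb

/-- The ear lemma. -/
theorem ear_lemma [Fintype V] {G : SimpleGraph V} (hG : KConnected 3 G) (A : Set V)
    (hA : ∃ a ∈ A, ∃ b ∈ A, a ≠ b) (u : V) (hu : u ∉ A)
    (hC : ∀ x ∉ A, ∀ y ∉ A, R G Aᶜ x y) (hne : ∃ x, x ∉ A ∧ x ≠ u) :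
    ∃ P : Set V, P.Nonempty ∧ (∀ p ∈ P, p ∉ A) ∧ u ∉ P ∧
      (∃ a ∈ A, ∃ b ∈ A, a ≠ b ∧ ∃ f, StOrd G P a b f) ∧
      (∀ x ∉ A ∪ P, ∀ y ∉ A ∪ P, R G (A ∪ P)ᶜ x y) ∧
      (∀ p ∈ P, ∃ y, y ∉ A ∪ P ∧ G.Adj p y) := by
  -- candidates
  let Cand : Set (Set V) := {X | (∀ x ∈ X, x ∉ A ∧ x ≠ u) ∧ Good G A X}
  have hCand : Cand.Nonempty := by
    obtain ⟨x, hxA, hxu⟩ := hne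
    let S : Set V := {y | y ∉ A ∧ y ≠ u}
    have hxS : x ∈ S := ⟨hxA, hxu⟩
    let K := comp G S x
    have hxK : x ∈ K := ⟨hxS, R.refl _⟩
    have huK : u ∉ K := fun h => h.1.2 rfl
    have hAK : ∀ a ∈ A, a ∉ K := fun a ha h => h.1.1 ha
    have hout : ∀ v ∈ K, ∀ y, y ∉ K → G.Adj v y → y ≠ u → y ∈ A := by
      intro v hv y hy hvy hyu
      by_contra hyA
      exact hy (mem_comp_of_adj hv ⟨hyA, hyu⟩ hvy)
    have hAu : ∀ a ∈ A, a ≠ u := fun a ha e => hu (e ▸ ha)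
    obtain ⟨a0, ha0, b0, hb0, hab0⟩ := hA
    obtain ⟨v1, hv1, a, haK, h1, hau, -⟩ :=
      cut hG hxK (hAK a0 ha0) huK huK (hAu _ ha0) (hAu _ ha0)
    have haA := hout v1 hv1 a haK h1 hau
    obtain ⟨z, hz, hza⟩ : ∃ z ∈ A, z ≠ a := by
      by_cases h : a0 = a
      · exact ⟨b0, hb0, fun h' => hab0 (h.trans h'.symm)⟩
      · exact ⟨a0, ha0, h⟩
    obtain ⟨v2, hv2, b, hbK, h2, hbu, hba⟩ :=
      cut hG hxK (hAK z hz) huK (hAK a haA) (hAu _ hz) hza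
    have hbA := hout v2 hv2 b hbK h2 hbu
    exact ⟨K, fun y hy => hy.1, a, haA, b, hbA, hba.symm, v1, hv1, v2, hv2, h1, h2,
      R_comp' hxS hv1 hv2⟩
  obtain ⟨X, hX, hmax⟩ := (Set.toFinite Cand).exists_maximalFor
    (fun X => (comp G {y | y ∉ A ∧ y ∉ X} u).ncard) Cand hCand
  set D := comp G {y | y ∉ A ∧ y ∉ X} u with hD
  have huS : u ∈ {y | y ∉ A ∧ y ∉ X} := ⟨hu, fun h => (hX.1 u h).2 rfl⟩
  have huD : u ∈ D := ⟨huS, R.refl _⟩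
  have hDA : ∀ d ∈ D, d ∉ A := fun d hd => hd.1.1
  let B : Set V := {y | y ∉ A ∧ y ∉ D}
  let W : Set V := {w | w ∈ B ∧ ∃ d ∈ D, G.Adj w d}
  have hM : ∀ X' ⊆ B, Good G A X' → W ⊆ X' := by
    intro X' hX'B hX' w hw
    by_contra hwX
    have hX'C : X' ∈ Cand :=
      ⟨fun x hx => ⟨(hX'B hx).1, fun e => (hX'B hx).2 (e ▸ huD)⟩, hX'⟩
    have hsub : D ⊆ comp G {y | y ∉ A ∧ y ∉ X'} u := by
      have hDs : D ⊆ {y | y ∉ A ∧ y ∉ X'} := fun d hd => ⟨hDA d hd, fun h => (hX'B h).2 hd⟩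
      intro d hd
      exact ⟨hDs hd, (R_comp' huS huD hd).mono hDs⟩
    have hle := hmax hX'C (Set.ncard_le_ncard hsub (Set.toFinite _))
    have heq := Set.eq_of_subset_of_ncard_le hsub hle (Set.toFinite _)
    obtain ⟨hwB, d, hd, hwd⟩ := hw
    apply hwB.2
    rw [heq] at hd ⊢
    exact mem_comp_of_adj hd ⟨hwB.1, hwX⟩ hwd.symm
  have hXB : X ⊆ B := fun x hx => ⟨(hX.1 x hx).1, fun h => h.1.2 hx⟩
  obtain ⟨a, ha, b, hb, hab, x1, hx1, y1, hy1, hxa, hyb, hR⟩ := hX.2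
  obtain ⟨P, hPX, f, ⟨p0, hp0⟩, hP⟩ := exists_stOrd hx1 hxa hyb hR
  have hPB : P ⊆ B := hPX.trans hXB
  have hWP : W ⊆ P := by
    apply hM P hPB
    obtain ⟨x, hx, -, hxa, hRx⟩ := hP.lowPart p0 hp0
    obtain ⟨y, hy, -, hyb, hRy⟩ := hP.highPart p0 hp0
    exact ⟨a, ha, b, hb, hab, x, hx, y, hy, hxa, hyb,
      (hRx.mono fun _ h => h.1).trans (hRy.symm.mono fun _ h => h.1)⟩
  obtain ⟨w0, hw0⟩ : W.Nonempty := by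
    obtain ⟨p, hp, q, hq, hpq, -, hqA⟩ :=
      (hC u hu p0 (hPB hp0).1).cross (K := D) huD (hPB hp0).2
    exact ⟨q, ⟨hqA, hq⟩, p, hp, hpq.symm⟩
  have hBW : B ⊆ W := by
    intro x hxB
    by_contra hxW
    let S : Set V := {y | y ∈ B ∧ y ∉ W}
    have hxS : x ∈ S := ⟨hxB, hxW⟩
    let K := comp G S x
    have hxK : x ∈ K := ⟨hxS, R.refl _⟩
    have hKB : K ⊆ B := fun y hy => hy.1.1
    have hKW : ∀ w ∈ W, w ∉ K := fun w hw h => h.1.2 hw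
    have hKA : ∀ w ∈ A, w ∉ K := fun w hw h => h.1.1.1 hw
    have hKK : ∀ y ∈ K, ∀ z ∈ K, R G K y z := fun y hy z hz => R_comp' hxS hy hz
    have huK : u ∉ K := fun h => h.1.1.2 huD
    have hAu : ∀ a ∈ A, u ≠ a := fun a ha e => hu (e ▸ ha)
    have hWu : ∀ a ∈ W, u ≠ a := fun a ha e => ha.1.2 (e ▸ huD)
    have hout : ∀ v ∈ K, ∀ y, y ∉ K → G.Adj v y → y ∉ A → y ∈ W := by
      intro v hv y hy hvy hyA
      by_contra hyW
      by_cases hyD : y ∈ D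
      · exact hv.1.2 ⟨hv.1.1, y, hyD, hvy⟩
      · exact hy (mem_comp_of_adj hv ⟨⟨hyA, hyD⟩, hyW⟩ hvy)
    have hone : ∀ c ∈ A, ∀ c' ∈ A, ∀ v ∈ K, ∀ v' ∈ K, G.Adj v c → G.Adj v' c' → c = c' := by
      intro c hc c' hc' v hv v' hv' h h'
      by_contra hcc
      exact hKW w0 hw0 (hM K hKB ⟨c, hc, c', hc', hcc, v, hv, v', hv', h, h', hKK v hv v' hv'⟩ hw0)
    -- an `A`-neighbour together with two `W`-neighbours is impossible
    have hA2 : ∀ c ∈ A, ∀ v ∈ K, G.Adj v c → ∀ w₁ ∈ W, ∀ w₂ ∈ W, ∀ v₁ ∈ K, ∀ v₂ ∈ K,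
        G.Adj v₁ w₁ → G.Adj v₂ w₂ → f w₁ < f w₂ → False := by
      intro c hc v hv hvc w₁ hw₁ w₂ hw₂ v₁ hv₁ v₂ hv₂ h₁ h₂ hlt
      by_cases hca : c = a
      · have hcb : c ≠ b := fun h => hab (hca.symm.trans h)
        obtain ⟨y, hy, hyf, hyb, hRy⟩ := hP.highPart w₂ (hWP hw₂)
        have := hM ({q | q ∈ P ∧ f w₂ ≤ f q} ∪ K)
          (Set.union_subset (fun q hq => hPB hq.1) hKB)
          ⟨c, hc, b, hb, hcb, v, .inr hv, y, .inl ⟨hy, hyf⟩, hvc, hyb,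
            ((hKK v hv v₂ hv₂).mono Set.subset_union_right).trans
            ((R.step h₂ (.inr hv₂) (.inl ⟨hWP hw₂, le_rfl⟩)).trans
              (hRy.symm.mono Set.subset_union_left))⟩ hw₁
        rcases this with h | h
        · exact absurd h.2 (not_le.2 hlt)
        · exact hKW _ hw₁ h
      · obtain ⟨y, hy, hyf, hyb, hRy⟩ := hP.lowPart w₁ (hWP hw₁)
        have := hM ({q | q ∈ P ∧ f q ≤ f w₁} ∪ K)
          (Set.union_subset (fun q hq => hPB hq.1) hKB)
          ⟨c, hc, a, ha, hca, v, .inr hv, y, .inl ⟨hy, hyf⟩, hvc, hyb,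
            ((hKK v hv v₁ hv₁).mono Set.subset_union_right).trans
            ((R.step h₁ (.inr hv₁) (.inl ⟨hWP hw₁, le_rfl⟩)).trans
              (hRy.symm.mono Set.subset_union_left))⟩ hw₂
        rcases this with h | h
        · exact absurd h.2 (not_le.2 hlt)
        · exact hKW _ hw₂ h
    -- three `W`-neighbours are impossible
    have hW3 : ∀ w₁ ∈ W, ∀ w₂ ∈ W, ∀ w₃ ∈ W, ∀ v₁ ∈ K, ∀ v₃ ∈ K,
        G.Adj v₁ w₁ → G.Adj v₃ w₃ → f w₁ < f w₂ → f w₂ < f w₃ → False := by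
      intro w₁ hw₁ w₂ hw₂ w₃ hw₃ v₁ hv₁ v₃ hv₃ h₁ h₃ hlt hlt'
      obtain ⟨x, hx, hxf, hxa, hRx⟩ := hP.lowPart w₁ (hWP hw₁)
      obtain ⟨y, hy, hyf, hyb, hRy⟩ := hP.highPart w₃ (hWP hw₃)
      have := hM ({q | q ∈ P ∧ (f q ≤ f w₁ ∨ f w₃ ≤ f q)} ∪ K)
          (Set.union_subset (fun q hq => hPB hq.1) hKB)
          ⟨a, ha, b, hb, hab, x, .inl ⟨hx, .inl hxf⟩, y, .inl ⟨hy, .inr hyf⟩, hxa, hyb,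
            (hRx.mono (fun q hq => .inl ⟨hq.1, .inl hq.2⟩)).trans
            ((R.step h₁.symm (.inl ⟨hWP hw₁, .inl le_rfl⟩) (.inr hv₁)).trans
            (((hKK v₁ hv₁ v₃ hv₃).mono Set.subset_union_right).trans
            ((R.step h₃ (.inr hv₃) (.inl ⟨hWP hw₃, .inr le_rfl⟩)).trans
              (hRy.symm.mono (fun q hq => .inl ⟨hq.1, .inr hq.2⟩)))))⟩ hw₂
      rcases this with ⟨-, h | h⟩ | h
      · exact absurd h (not_le.2 hlt)
      · exact absurd h (not_le.2 hlt')
      · exact hKW _ hw₂ h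
    have hfne : ∀ w ∈ W, ∀ w' ∈ W, w ≠ w' → f w < f w' ∨ f w' < f w := by
      intro w hw w' hw' hne
      exact lt_or_gt_of_ne (fun e => hne (hP.1 w (hWP hw) w' (hWP hw') e))
    by_cases hc : ∃ c ∈ A, ∃ v ∈ K, G.Adj v c
    · obtain ⟨c, hc, v, hv, hvc⟩ := hc
      obtain ⟨v₁, hv₁, w₁, hw₁K, h₁, hw₁c, -⟩ :=
        cut hG hxK huK (hKA c hc) (hKA c hc) (hAu c hc) (hAu c hc)
      have hw₁ := hout v₁ hv₁ w₁ hw₁K h₁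
        (fun h => hw₁c (hone _ h _ hc v₁ hv₁ v hv h₁ hvc))
      obtain ⟨v₂, hv₂, w₂, hw₂K, h₂, hw₂c, hw₂₁⟩ :=
        cut hG hxK huK (hKA c hc) hw₁K (hAu c hc) (hWu _ hw₁)
      have hw₂ := hout v₂ hv₂ w₂ hw₂K h₂
        (fun h => hw₂c (hone _ h _ hc v₂ hv₂ v hv h₂ hvc))
      rcases hfne _ hw₁ _ hw₂ hw₂₁.symm with h | h
      · exact hA2 c hc v hv hvc w₁ hw₁ w₂ hw₂ v₁ hv₁ v₂ hv₂ h₁ h₂ h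
      · exact hA2 c hc v hv hvc w₂ hw₂ w₁ hw₁ v₂ hv₂ v₁ hv₁ h₂ h₁ h
    · have hnA : ∀ v ∈ K, ∀ y, G.Adj v y → y ∉ A := fun v hv y h hy => hc ⟨y, hy, v, hv, h⟩
      obtain ⟨v₁, hv₁, w₁, hw₁K, h₁, -, -⟩ :=
        cut hG hxK huK (hKA a ha) (hKA a ha) (hAu a ha) (hAu a ha)
      have hw₁ := hout v₁ hv₁ w₁ hw₁K h₁ (hnA _ hv₁ _ h₁)
      obtain ⟨v₂, hv₂, w₂, hw₂K, h₂, hw₂₁, -⟩ :=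
        cut hG hxK huK hw₁K hw₁K (hWu _ hw₁) (hWu _ hw₁)
      have hw₂ := hout v₂ hv₂ w₂ hw₂K h₂ (hnA _ hv₂ _ h₂)
      obtain ⟨v₃, hv₃, w₃, hw₃K, h₃, hw₃₁, hw₃₂⟩ :=
        cut hG hxK huK hw₁K hw₂K (hWu _ hw₁) (hWu _ hw₂)
      have hw₃ := hout v₃ hv₃ w₃ hw₃K h₃ (hnA _ hv₃ _ h₃)
      rcases hfne _ hw₁ _ hw₂ hw₂₁.symm with h12 | h12 <;>
      rcases hfne _ hw₁ _ hw₃ hw₃₁.symm with h13 | h13 <;>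
      rcases hfne _ hw₂ _ hw₃ hw₃₂.symm with h23 | h23
      · exact hW3 _ hw₁ _ hw₂ _ hw₃ _ hv₁ _ hv₃ h₁ h₃ h12 h23
      · exact hW3 _ hw₁ _ hw₃ _ hw₂ _ hv₁ _ hv₂ h₁ h₂ h13 h23
      · linarith
      · exact hW3 _ hw₃ _ hw₁ _ hw₂ _ hv₃ _ hv₂ h₃ h₂ h13 h12
      · exact hW3 _ hw₂ _ hw₁ _ hw₃ _ hv₂ _ hv₃ h₂ h₃ h12 h13
      · linarith
      · exact hW3 _ hw₂ _ hw₃ _ hw₁ _ hv₂ _ hv₁ h₂ h₁ h23 h13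
      · exact hW3 _ hw₃ _ hw₂ _ hw₁ _ hv₃ _ hv₁ h₃ h₁ h23 h12
  have hBP : B ⊆ P := hBW.trans hWP
  have hDeq : ∀ y, y ∉ A ∪ P ↔ y ∈ D := by
    intro y
    constructor
    · intro hy
      by_contra hyD
      exact hy (.inr (hBP ⟨fun h => hy (.inl h), hyD⟩))
    · rintro hy (h | h)
      · exact hDA y hy h
      · exact (hPB h).2 hy
  have hDeq' : (A ∪ P)ᶜ = D := Set.ext hDeq
  refine ⟨P, ⟨p0, hp0⟩, fun p hp => (hPB hp).1, fun h => (hPB h).2 huD,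
    ⟨a, ha, b, hb, hab, f, hP⟩, ?_, ?_⟩
  · intro x hx y hy
    rw [hDeq']
    exact R_comp' huS ((hDeq x).1 hx) ((hDeq y).1 hy)
  · intro p hp
    obtain ⟨-, d, hd, h⟩ := hBW (hPB hp)
    exact ⟨d, (hDeq d).2 hd, h⟩

/-- Inserting an ordered set between two elements of an order. -/
theorem insert_order [Fintype V] (A P : Set V) (o f : V → ℚ) (hPA : ∀ p ∈ P, p ∉ A)
    (ho : ∀ x ∈ A, ∀ y ∈ A, o x = o y → x = y) (hf : ∀ x ∈ P, ∀ y ∈ P, f x = f y → x = y)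
    (a b : V) (hb : b ∈ A) (hab : o a < o b) :
    ∃ o' : V → ℚ, (∀ x ∈ A, o' x = o x) ∧
      (∀ x ∈ A ∪ P, ∀ y ∈ A ∪ P, o' x = o' y → x = y) ∧
      (∀ p ∈ P, o a < o' p ∧ o' p < o b) ∧
      (∀ p ∈ P, ∀ q ∈ P, f p < f q → o' p < o' q) := by
  classical
  obtain ⟨β, hβ, hβb, hgap⟩ : ∃ β, o a < β ∧ β ≤ o b ∧ ∀ x ∈ A, o a < o x → β ≤ o x := by
    obtain ⟨m, hm, hmin⟩ := (Set.toFinite {x | x ∈ A ∧ o a < o x}).exists_minimalFor o _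
      ⟨b, hb, hab⟩
    have hmin' : ∀ x ∈ A, o a < o x → o m ≤ o x := by
      intro x hx hax
      rcases le_total (o m) (o x) with h | h
      · exact h
      · exact hmin ⟨hx, hax⟩ h
    exact ⟨o m, hm.2, hmin' b hb hab, hmin'⟩
  obtain ⟨M, hM0, hM⟩ : ∃ M : ℚ, 0 < M ∧ ∀ x, |f x| < M := by
    refine ⟨∑ x, |f x| + 1, by positivity, fun x => ?_⟩
    have := Finset.single_le_sum (f := fun x => |f x|) (fun i _ => abs_nonneg _)
      (Finset.mem_univ x)
    linarith
  let g : V → ℚ := fun x => o a + (β - o a) * ((f x + M) / (2 * M))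
  have hβ' : 0 < β - o a := by linarith
  have hg : ∀ x, o a < g x ∧ g x < β := by
    intro x
    have h1 := abs_lt.1 (hM x)
    have h2 : 0 < (f x + M) / (2 * M) := div_pos (by linarith) (by linarith)
    have h3 : (f x + M) / (2 * M) < 1 := by rw [div_lt_one (by linarith)]; linarith
    constructor
    · have := mul_pos hβ' h2
      simp only [g]; linarith
    · have := mul_lt_mul_of_pos_left h3 hβ'
      simp only [g]; linarith
  have hmono : ∀ x y, f x < f y → g x < g y := by
    intro x y h
    have h3 : (f x + M) / (2 * M) < (f y + M) / (2 * M) :=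
      div_lt_div_of_pos_right (by linarith) (by linarith)
    have := mul_lt_mul_of_pos_left h3 hβ'
    simp only [g]; linarith
  have hinj : ∀ x ∈ P, ∀ y ∈ P, g x = g y → x = y := by
    intro x hx y hy e
    apply hf x hx y hy
    rcases lt_trichotomy (f x) (f y) with h | h | h
    · exact absurd e (hmono _ _ h).ne
    · exact h
    · exact absurd e (hmono _ _ h).ne'
  have hAP : ∀ x ∈ A, ∀ p, o x ≠ g p := by
    intro x hx p e
    have := hgap x hx (by rw [e]; exact (hg p).1)
    have := (hg p).2
    linarith
  have oP : ∀ p ∈ P, (if p ∈ A then o p else g p) = g p := fun p hp => if_neg (hPA p hp)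
  have oA : ∀ p ∈ A, (if p ∈ A then o p else g p) = o p := fun p hp => if_pos hp
  refine ⟨fun x => if x ∈ A then o x else g x, oA, ?_, ?_, ?_⟩
  · rintro x (hx | hx) y (hy | hy) e
    · simp only [oA _ hx, oA _ hy] at e; exact ho x hx y hy e
    · simp only [oA _ hx, oP _ hy] at e; exact absurd e (hAP x hx y)
    · simp only [oP _ hx, oA _ hy] at e; exact absurd e.symm (hAP y hy x)
    · simp only [oP _ hx, oP _ hy] at e; exact hinj x hx y hy e
  · intro p hp
    simp only [oP _ hp]
    exact ⟨(hg p).1, (hg p).2.trans_le hβb⟩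
  · intro p hp q hq h
    simp only [oP _ hp, oP _ hq]
    exact hmono _ _ h

/-- The whole construction of the order and the levels. -/
theorem construct [Fintype V] {G : SimpleGraph V} (hG : KConnected 3 G) (u : V) (n : ℕ) :
    ∀ (A : Set V) (o : V → ℚ), Aᶜ.ncard ≤ n → (∃ a ∈ A, ∃ b ∈ A, a ≠ b) → u ∉ A →
    (∀ x ∉ A, ∀ y ∉ A, R G Aᶜ x y) → (∀ x ∈ A, ∀ y ∈ A, o x = o y → x = y) →
    ∃ (o' : V → ℚ) (l : V → ℕ), (∀ x ∈ A, o' x = o x) ∧ (∀ x ∈ A, l x = 0) ∧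
      (∀ x ∉ A, 1 ≤ l x) ∧ ∀ x ∉ A, x ≠ u →
        (∃ y, G.Adj x y ∧ o' y < o' x ∧ l y ≤ l x) ∧
        (∃ y, G.Adj x y ∧ o' x < o' y ∧ l y ≤ l x) ∧
        (∃ y, G.Adj x y ∧ l x < l y) := by
  classical
  induction n with
  | zero =>
    intro A o hn _ hu
    have : Aᶜ = ∅ := (Set.ncard_eq_zero (Set.toFinite _)).1 (by omega)
    exact absurd (show u ∈ Aᶜ from hu) (by simp [this])
  | succ n ih =>
    intro A o hn hA hu hC ho
    by_cases hne : ∃ x, x ∉ A ∧ x ≠ u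
    · obtain ⟨P, ⟨p0, hp0⟩, hPA, huP, ⟨a, ha, b, hb, hab, f, hf⟩, hconn, hnb⟩ :=
        ear_lemma hG A hA u hu hC hne
      obtain ⟨a, ha, b, hb, hab, f, hf⟩ : ∃ a ∈ A, ∃ b ∈ A, o a < o b ∧ ∃ f, StOrd G P a b f := by
        rcases lt_or_gt_of_ne (fun e => hab (ho a ha b hb e)) with h | h
        · exact ⟨a, ha, b, hb, h, f, hf⟩
        · exact ⟨b, hb, a, ha, h, _, hf.swap⟩
      obtain ⟨o1, ho1A, ho1inj, ho1ab, ho1mono⟩ :=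
        insert_order A P o f hPA ho hf.1 a b hb hab
      obtain ⟨o', l, ho', hl0, hl1, hx⟩ := ih (A ∪ P) o1
        (by
          have : (A ∪ P)ᶜ ⊂ Aᶜ := by
            refine ⟨fun y hy h => hy (.inl h), fun h => ?_⟩
            exact h (show p0 ∈ Aᶜ from hPA p0 hp0) (.inr hp0)
          have := Set.ncard_lt_ncard this (Set.toFinite _)
          omega)
        (by obtain ⟨a, ha, b, hb, h⟩ := hA; exact ⟨a, .inl ha, b, .inl hb, h⟩)
        (by rintro (h | h); exacts [hu h, huP h]) hconn ho1inj
      let l' : V → ℕ := fun x => if x ∈ A then 0 else l x + 1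
      have lA : ∀ x ∈ A, l' x = 0 := fun x hx => if_pos hx
      have lC : ∀ x ∉ A, l' x = l x + 1 := fun x hx => if_neg hx
      have lP : ∀ x ∈ P, l' x = 1 := fun x hx => by rw [lC x (hPA x hx), hl0 x (.inr hx)]
      have lle : ∀ x y, x ∉ A → l y ≤ l x → l' y ≤ l' x := by
        intro x y hx h
        rw [lC x hx]
        by_cases hy : y ∈ A
        · rw [lA y hy]; omega
        · rw [lC y hy]; omega
      refine ⟨o', l', fun x hx => (ho' x (.inl hx)).trans (ho1A x hx), lA,
        fun x hx => by rw [lC x hx]; omega, ?_⟩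
      intro x hxA hxu
      by_cases hxP : x ∈ P
      · have e := ho' x (.inr hxP)
        refine ⟨?_, ?_, ?_⟩
        · rcases hf.2.1 x hxP with h | ⟨q, hq, h1, h2⟩
          · refine ⟨a, h, ?_, by rw [lA a ha]; omega⟩
            rw [e, ho' a (.inl ha), ho1A a ha]
            exact (ho1ab x hxP).1
          · refine ⟨q, h1, ?_, by rw [lP q hq, lP x hxP]⟩
            rw [e, ho' q (.inr hq)]
            exact ho1mono q hq x hxP h2
        · rcases hf.2.2 x hxP with h | ⟨q, hq, h1, h2⟩
          · refine ⟨b, h, ?_, by rw [lA b hb]; omega⟩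
            rw [e, ho' b (.inl hb), ho1A b hb]
            exact (ho1ab x hxP).2
          · refine ⟨q, h1, ?_, by rw [lP q hq, lP x hxP]⟩
            rw [e, ho' q (.inr hq)]
            exact ho1mono x hxP q hq h2
        · obtain ⟨y, hy, h⟩ := hnb x hxP
          refine ⟨y, h, ?_⟩
          have := hl1 y hy
          rw [lP x hxP, lC y (fun h => hy (.inl h))]
          omega
      · obtain ⟨⟨y1, h1, h1', h1''⟩, ⟨y2, h2, h2', h2''⟩, ⟨y3, h3, h3'⟩⟩ :=
          hx x (by rintro (h | h); exacts [hxA h, hxP h]) hxu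
        refine ⟨⟨y1, h1, h1', lle _ _ hxA h1''⟩, ⟨y2, h2, h2', lle _ _ hxA h2''⟩, ⟨y3, h3, ?_⟩⟩
        have hy3 : y3 ∉ A := fun h => by
          rw [hl0 y3 (.inl h)] at h3'; omega
        rw [lC x hxA, lC y3 hy3]; omega
    · refine ⟨o, fun x => if x ∈ A then 0 else 1, fun _ _ => rfl, fun x hx => if_pos hx,
        fun x hx => by simp [hx], fun x hx hxu => absurd ⟨x, hx, hxu⟩ hne⟩

/-- The graph of a parent function. -/
def parGraph (r : V) (π : V → V) : SimpleGraph V :=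
  SimpleGraph.fromRel (fun x y => x ≠ r ∧ y = π x)

theorem parGraph_adj {r : V} {π : V → V} {x y : V} (h : (parGraph r π).Adj x y) :
    (x ≠ r ∧ y = π x) ∨ (y ≠ r ∧ x = π y) := by
  rw [parGraph, SimpleGraph.fromRel_adj] at h
  exact h.2

/-- Ancestor relation. -/
def Anc (r : V) (π : V → V) : V → V → Prop :=
  Relation.ReflTransGen (fun x y => x ≠ r ∧ y = π x)

theorem no_down {G : SimpleGraph V} {r : V} {π : V → V} {y z : V} (q : G.Walk y z) (hz : z = r)
    (hq : q.IsPath) (he : ∀ e ∈ q.edges, e ∈ (parGraph r π).edgeSet)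
    (hy : y ≠ r) (hpi : π y ∉ q.support) : False := by
  induction q with
  | nil => exact hy hz
  | @cons u v w h p ih =>
    rw [Walk.cons_isPath_iff] at hq
    have hadj : (parGraph r π).Adj u v := he s(u, v) (by simp)
    rcases parGraph_adj hadj with ⟨-, h2⟩ | ⟨h1, h2⟩
    · exact hpi (by rw [← h2]; simp)
    · exact ih hz hq.1 (fun e hep => he e (by simp [hep])) h1 (by rw [← h2]; exact hq.2)

theorem path_anc {G : SimpleGraph V} {r : V} {π : V → V} {y z : V} (q : G.Walk y z) (hz : z = r)
    (hq : q.IsPath) (he : ∀ e ∈ q.edges, e ∈ (parGraph r π).edgeSet) :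
    ∀ v ∈ q.support, Anc r π y v := by
  induction q with
  | nil =>
    intro v hv
    simp only [Walk.support_nil, List.mem_singleton] at hv
    subst hv
    exact Relation.ReflTransGen.refl
  | @cons u v w h p ih =>
    rw [Walk.cons_isPath_iff] at hq
    have hadj : (parGraph r π).Adj u v := he s(u, v) (by simp)
    have he' : ∀ e ∈ p.edges, e ∈ (parGraph r π).edgeSet := fun e hep => he e (by simp [hep])
    intro x hx
    rw [Walk.support_cons, List.mem_cons] at hx
    rcases hx with rfl | hx
    · exact Relation.ReflTransGen.refl
    rcases parGraph_adj hadj with h1 | ⟨h1, h2⟩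
    · exact Relation.ReflTransGen.head h1 (ih hz hq.1 he' x hx)
    · exact (no_down p hz hq.1 he' h1 (by rw [← h2]; exact hq.2)).elim

/-- A parent function yields a spanning tree. -/
theorem exists_tree [Fintype V] {G : SimpleGraph V} (r : V) (π : V → V) (g : V → ℚ)
    (hadj : ∀ x, x ≠ r → G.Adj x (π x)) (hg : ∀ x, x ≠ r → π x = r ∨ g (π x) < g x) :
    ∃ T : G.Subgraph, IsSpanningTreeSub G T ∧
      ∀ x, ∀ p : G.Walk r x, p.IsPath → (∀ e ∈ p.edges, e ∈ T.edgeSet) →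
        ∀ v ∈ p.support, Anc r π x v := by
  have hle : parGraph r π ≤ G := by
    intro x y h
    rcases parGraph_adj h with ⟨h1, rfl⟩ | ⟨h1, rfl⟩
    · exact hadj x h1
    · exact (hadj y h1).symm
  have hreach : ∀ x, (parGraph r π).Reachable x r := by
    refine fin_induct g ?_
    intro x ih
    by_cases hx : x = r
    · rw [hx]
    have h1 : (parGraph r π).Adj x (π x) := by
      rw [parGraph, SimpleGraph.fromRel_adj]
      exact ⟨(hadj x hx).ne, .inl ⟨hx, rfl⟩⟩
    rcases hg x hx with h | h
    · rw [h] at h1; exact h1.reachable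
    · exact h1.reachable.trans (ih _ h)
  have hconn : (parGraph r π).Connected :=
    { preconnected := fun x y => (hreach x).trans (hreach y).symm
      nonempty := ⟨r⟩ }
  obtain ⟨T, hT, hTtree⟩ := hconn.exists_isTree_le
  refine ⟨SimpleGraph.toSubgraph T (hT.trans hle), ⟨rfl, ?_⟩, ?_⟩
  · exact ((SimpleGraph.toSubgraph T (hT.trans hle)).spanningCoeEquivCoeOfSpanning
      (SimpleGraph.toSubgraph.isSpanning T _)).isTree_iff.1 hTtree
  · intro x p hp he v hv
    refine path_anc p.reverse rfl hp.reverse ?_ v (by simpa using hv)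
    intro e hep
    have := he e (by simpa using hep)
    induction e with
    | h a b => exact hT this

theorem indep [Fintype V] {G : SimpleGraph V} {r : V} {π π' : V → V} {T T' : G.Subgraph}
    (hT : ∀ x, ∀ p : G.Walk r x, p.IsPath → (∀ e ∈ p.edges, e ∈ T.edgeSet) →
        ∀ v ∈ p.support, Anc r π x v)
    (hT' : ∀ x, ∀ p : G.Walk r x, p.IsPath → (∀ e ∈ p.edges, e ∈ T'.edgeSet) →
        ∀ v ∈ p.support, Anc r π' x v)
    (C C' : V → V → Prop) (hC : ∀ x y z, C x y → C y z → C x z)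
    (hC' : ∀ x y z, C' x y → C' y z → C' x z)
    (h : ∀ x, x ≠ r → π x = r ∨ C x (π x)) (h' : ∀ x, x ≠ r → π' x = r ∨ C' x (π' x))
    (hCC : ∀ x y, C x y → C' x y → False) : IndepPair T T' r := by
  have key : ∀ (ρ : V → V) (E : V → V → Prop), (∀ x y z, E x y → E y z → E x z) →
      (∀ x, x ≠ r → ρ x = r ∨ E x (ρ x)) → ∀ x v, Anc r ρ x v → v = r ∨ v = x ∨ E x v := by
    intro ρ E htr hE x v hv
    induction hv with
    | refl => exact .inr (.inl rfl)
    | @tail b c _ h2 ih =>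
      obtain ⟨hb, rfl⟩ := h2
      rcases hE b hb with h1 | h1
      · exact .inl h1
      · rcases ih with h3 | rfl | h3
        · exact absurd h3 hb
        · exact .inr (.inr h1)
        · exact .inr (.inr (htr _ _ _ h3 h1))
  intro x _ p q hp hq hpe hqe v hvp hvq
  rcases key π C hC h x v (hT x p hp hpe v hvp) with h1 | h1 | h1
  · exact .inl h1
  · exact .inr h1
  rcases key π' C' hC' h' x v (hT' x q hq hqe v hvq) with h2 | h2 | h2
  · exact .inl h2
  · exact .inr h2
  · exact (hCC _ _ h1 h2).elim

end ThreeTrees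

open ThreeTrees

/-- Every finite simple 3-connected graph `G` contains three
independent spanning trees; moreover, for every vertex `r` of `G` there exist three
independent spanning trees of `G` all rooted at `r`. -/
theorem three_independent_spanning_trees {V : Type u} [Fintype V] (G : SimpleGraph V)
    (hG : KConnected 3 G) :
    ∀ r : V, ∃ T₁ T₂ T₃ : G.Subgraph,
      IsSpanningTreeSub G T₁ ∧ IsSpanningTreeSub G T₂ ∧ IsSpanningTreeSub G T₃ ∧
      IndepPair T₁ T₂ r ∧ IndepPair T₁ T₃ r ∧ IndepPair T₂ T₃ r := by
  classical
  intro r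
  have hcard : 4 ≤ Fintype.card V := by
    have := hG.1
    rw [Nat.card_eq_fintype_card] at this
    omega
  have hpick : ∀ s : Finset V, s.card ≤ 3 → ∃ z, z ∉ s := by
    intro s hs
    by_contra h
    push Not at h
    have : s = Finset.univ := Finset.eq_univ_iff_forall.2 h
    rw [this, Finset.card_univ] at hs
    omega
  obtain ⟨p, hp⟩ := hpick {r} (by simp)
  obtain ⟨z, hz⟩ := hpick {r, p} (Finset.card_le_two.trans (by norm_num))
  simp only [Finset.mem_singleton, Finset.mem_insert, not_or] at hp hz
  obtain ⟨t, htr, hrt⟩ : ∃ t, t ≠ r ∧ G.Adj r t := by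
    obtain ⟨r', hr', t, htr, hrt, -, -⟩ :=
      cut hG (K := {r}) rfl hz.1 hp hp hz.2 hz.2
    rw [Set.mem_singleton_iff] at hr'
    exact ⟨t, htr, hr' ▸ hrt⟩
  obtain ⟨z', hz'⟩ := hpick {r, t} (Finset.card_le_two.trans (by norm_num))
  simp only [Finset.mem_singleton, Finset.mem_insert, not_or] at hz'
  obtain ⟨u, hur, hru, hut⟩ : ∃ u, u ≠ r ∧ G.Adj r u ∧ u ≠ t := by
    obtain ⟨r', hr', u, hur, hru, hut, -⟩ :=
      cut hG (K := {r}) rfl hz'.1 htr htr hz'.2 hz'.2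
    rw [Set.mem_singleton_iff] at hr'
    exact ⟨u, hur, hr' ▸ hru, hut⟩
  have hconn := hG.2 {r, t} (lt_of_le_of_lt (Set.ncard_insert_le _ _) (by simp))
  obtain ⟨o, l, -, -, -, hx⟩ := construct hG u _ {r, t} (fun x => if x = r then 0 else 1) le_rfl
    ⟨r, by simp, t, by simp, htr.symm⟩ (by simp [hur, hut])
    (fun x hx y hy => R.of_induce hconn hx hy)
    (by
      rintro x (rfl | rfl) y (rfl | rfl) e
      · rfl
      · simp [htr] at e
      · simp [htr] at e
      · rfl)
  have hall : ∀ x, x ≠ r → G.Adj x r ∨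
      ((∃ y, G.Adj x y ∧ o y < o x ∧ l y ≤ l x) ∧ (∃ y, G.Adj x y ∧ o x < o y ∧ l y ≤ l x) ∧
        (∃ y, G.Adj x y ∧ l x < l y)) := by
    intro x hxr
    by_cases hxt : x = t
    · left; rw [hxt]; exact hrt.symm
    by_cases hxu : x = u
    · left; rw [hxu]; exact hru.symm
    exact .inr (hx x (by simp [hxr, hxt]) hxu)
  have choose_parent : ∀ C : V → V → Prop, (∀ x, x ≠ r → G.Adj x r ∨ ∃ y, G.Adj x y ∧ C x y) →
      ∃ π : V → V, (∀ x, x ≠ r → G.Adj x (π x)) ∧ (∀ x, x ≠ r → π x = r ∨ C x (π x)) := by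
    intro C h
    have : ∀ x, ∃ y, x ≠ r → G.Adj x y ∧ (y = r ∨ C x y) := by
      intro x
      by_cases hxr : x = r
      · exact ⟨r, fun h => absurd hxr h⟩
      · rcases h x hxr with h | ⟨y, h1, h2⟩
        · exact ⟨r, fun _ => ⟨h, .inl rfl⟩⟩
        · exact ⟨y, fun _ => ⟨h1, .inr h2⟩⟩
    choose π hπ using this
    exact ⟨π, fun x hx => (hπ x hx).1, fun x hx => (hπ x hx).2⟩
  obtain ⟨π₁, hA₁, hC₁⟩ := choose_parent (fun x y => o y < o x ∧ l y ≤ l x)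
    (fun x hx => (hall x hx).imp_right fun h => h.1)
  obtain ⟨π₂, hA₂, hC₂⟩ := choose_parent (fun x y => o x < o y ∧ l y ≤ l x)
    (fun x hx => (hall x hx).imp_right fun h => h.2.1)
  obtain ⟨π₃, hA₃, hC₃⟩ := choose_parent (fun x y => l x < l y)
    (fun x hx => (hall x hx).imp_right fun h => h.2.2)
  obtain ⟨T₁, hT₁, hP₁⟩ := exists_tree r π₁ o hA₁ (fun x hx => (hC₁ x hx).imp_right fun h => h.1)
  obtain ⟨T₂, hT₂, hP₂⟩ := exists_tree r π₂ (fun x => - o x) hA₂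
    (fun x hx => (hC₂ x hx).imp_right fun h => neg_lt_neg h.1)
  obtain ⟨T₃, hT₃, hP₃⟩ := exists_tree r π₃ (fun x => - (l x : ℚ)) hA₃
    (fun x hx => (hC₃ x hx).imp_right fun h => neg_lt_neg (by exact_mod_cast h))
  refine ⟨T₁, T₂, T₃, hT₁, hT₂, hT₃, ?_, ?_, ?_⟩
  · exact indep hP₁ hP₂ (fun x y => o y < o x ∧ l y ≤ l x) (fun x y => o x < o y ∧ l y ≤ l x)
      (fun x y z h h' => ⟨h'.1.trans h.1, h'.2.trans h.2⟩)
      (fun x y z h h' => ⟨h.1.trans h'.1, h'.2.trans h.2⟩) hC₁ hC₂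
      (fun x y h h' => lt_asymm h.1 h'.1)
  · exact indep hP₁ hP₃ (fun x y => o y < o x ∧ l y ≤ l x) (fun x y => l x < l y)
      (fun x y z h h' => ⟨h'.1.trans h.1, h'.2.trans h.2⟩)
      (fun x y z h h' => h.trans h') hC₁ hC₃ (fun x y h h' => not_lt.2 h.2 h')
  · exact indep hP₂ hP₃ (fun x y => o x < o y ∧ l y ≤ l x) (fun x y => l x < l y)
      (fun x y z h h' => ⟨h.1.trans h'.1, h'.2.trans h.2⟩)
      (fun x y z h h' => h.trans h') hC₂ hC₃ (fun x y h h' => not_lt.2 h.2 h')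
end
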